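/- arXiv:math/0502312 — 3 statements merged into one kernel-verified Lean document; each statement's English description precedes it below -/
import Mathlib

section
/- Let n ≥ 2 and l ≥ 0 be integers and let X ⊆ 𝕊^{n-1} be a tight spherical (2l)-design, i.e. a spherical (2l)-design with |X| = dim_ℝ F^{(l)}(𝕊^{n-1}) = C(n+l−1, n−1) + C(n+l−2, n−1). Then the set A_X = {c ∈ [−1,1) : c = ⟨x,y⟩ for some x,y ∈ X with x ≠ y} coincides with the set of real roots of the polynomial R^{(l)} = ∑_{j=0}^{l} Q^{(j)}. -/
open MeasureTheory Finset
open scoped RealInnerProductSpace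

section SphereIntegrals

open MvPolynomial

variable {n : ℕ}

lemma MvPolynomial.hasDerivAt_eval_comp (p : MvPolynomial (Fin n) ℝ) {y y' : ℝ → Fin n → ℝ} {t : ℝ}
    (hy : ∀ d, HasDerivAt (fun s => y s d) (y' t d) t) :
    HasDerivAt (fun s => eval (y s) p) (∑ d, eval (y t) (pderiv d p) * y' t d) t := by
  induction p using MvPolynomial.induction_on with
  | C a => simpa using hasDerivAt_const t a
  | add p q hp hq => simpa [add_mul, sum_add_distrib] using hp.fun_add hq
  | mul_X p i hp =>
    have h := hp.fun_mul (hy i)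
    have e : (fun s => eval (y s) (p * X i)) = fun s => eval (y s) p * y s i := by
      funext s
      simp
    rw [e]
    refine h.congr_deriv ?_
    simp only [Derivation.leibniz, smul_eq_mul, map_add, map_mul, eval_X, add_mul,
      sum_add_distrib, pderiv_X, Pi.single_apply, sum_mul]
    rw [add_comm]
    congr 1
    · simp [apply_ite]
    · exact sum_congr rfl fun d _ => by ring

lemma MvPolynomial.continuous_eval_euclidean (p : MvPolynomial (Fin n) ℝ) :
    Continuous fun ω : EuclideanSpace ℝ (Fin n) => eval (fun d => ω d) p :=
  p.continuous_eval.comp (by fun_prop)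

variable {σ : Measure (EuclideanSpace ℝ (Fin n))}

lemma ae_mem_sphere (hsupp : σ (Metric.sphere (0 : EuclideanSpace ℝ (Fin n)) 1)ᶜ = 0) :
    ∀ᵐ ω ∂σ, ω ∈ Metric.sphere (0 : EuclideanSpace ℝ (Fin n)) 1 :=
  mem_ae_iff.2 hsupp

lemma MvPolynomial.exists_bound_eval_sphere (p : MvPolynomial (Fin n) ℝ) :
    ∃ B : ℝ, ∀ ω ∈ Metric.sphere (0 : EuclideanSpace ℝ (Fin n)) 1,
      ‖eval (fun d => ω d) p‖ ≤ B :=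
  (isCompact_sphere 0 1).exists_bound_of_continuousOn p.continuous_eval_euclidean.continuousOn

variable [IsProbabilityMeasure σ]

lemma MvPolynomial.integrable_eval
    (hsupp : σ (Metric.sphere (0 : EuclideanSpace ℝ (Fin n)) 1)ᶜ = 0)
    (p : MvPolynomial (Fin n) ℝ) :
    Integrable (fun ω : EuclideanSpace ℝ (Fin n) => eval (fun d => ω d) p) σ := by
  obtain ⟨B, hB⟩ := p.exists_bound_eval_sphere
  refine Integrable.of_bound p.continuous_eval_euclidean.aestronglyMeasurable B ?_
  filter_upwards [ae_mem_sphere hsupp] with ω hω using hB ω hω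

/-- The integral of the infinitesimal rotation of a polynomial vanishes. -/
lemma integral_infinitesimal_rotation_eq_zero
    (hsupp : σ (Metric.sphere (0 : EuclideanSpace ℝ (Fin n)) 1)ᶜ = 0)
    (hinv : ∀ g : EuclideanSpace ℝ (Fin n) ≃ₗᵢ[ℝ] EuclideanSpace ℝ (Fin n),
      MeasurePreserving g σ σ)
    (p : MvPolynomial (Fin n) ℝ) (a b : Fin n) :
    ∫ ω, eval (fun d => ω d) (X a * pderiv b p - X b * pderiv a p) ∂σ = 0 := by
  rcases eq_or_ne a b with rfl | hab
  · simp
  set q := X a * pderiv b p - X b * pderiv a p with hq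
  let u : ℝ → EuclideanSpace ℝ (Fin n) := fun t =>
    Real.cos t • EuclideanSpace.single a 1 + Real.sin t • EuclideanSpace.single b 1
  let G : ℝ → EuclideanSpace ℝ (Fin n) ≃ₗᵢ[ℝ] EuclideanSpace ℝ (Fin n) := fun t =>
    Submodule.reflection (Submodule.span ℝ {u t})
  have hu : ∀ t, ‖u t‖ ^ 2 = 1 := fun t => by
    rw [← real_inner_self_eq_norm_sq]
    simp only [u, inner_add_left, inner_add_right, real_inner_smul_left, real_inner_smul_right,
      EuclideanSpace.inner_single_left, PiLp.single_apply]
    simp [hab, hab.symm]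
    nlinarith [Real.cos_sq_add_sin_sq t]
  have hG : ∀ t (ω : EuclideanSpace ℝ (Fin n)) d, (G t ω) d =
      2 * (Real.cos t * ω a + Real.sin t * ω b) *
        (Real.cos t * (if d = a then 1 else 0) + Real.sin t * (if d = b then 1 else 0)) - ω d := by
    intro t ω d
    simp only [G, Submodule.reflection_singleton_apply, RCLike.ofReal_real_eq_id, id, hu t]
    simp [u, inner_add_left, real_inner_smul_left, EuclideanSpace.inner_single_left,
      PiLp.single_apply]
    split_ifs <;> ring
  have hderiv : ∀ (ω : EuclideanSpace ℝ (Fin n)) (t : ℝ),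
      HasDerivAt (fun t => eval (fun d => G t ω d) p) (2 * eval (fun d => G t ω d) q) t := by
    intro ω t
    have h := p.hasDerivAt_eval_comp (t := t) (y := fun t d => G t ω d)
      (y' := fun t d =>
        2 * (G t ω a * (if d = b then 1 else 0) - G t ω b * (if d = a then 1 else 0)))
      (fun d => by
        simp only [hG]
        have hc := Real.hasDerivAt_cos t
        have hs := Real.hasDerivAt_sin t
        refine (((((hc.mul_const (ω a)).fun_add (hs.mul_const (ω b))).const_mul 2).fun_mul
          ((hc.mul_const (if d = a then (1 : ℝ) else 0)).fun_add
            (hs.mul_const (if d = b then (1 : ℝ) else 0)))).sub_const (ω d)).congr_deriv ?_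
        have h1 := Real.sin_sq_add_cos_sq t
        by_cases hda : d = a
        · subst hda
          simp only [hab, hab.symm, if_true, if_false]
          linear_combination (2 * ω b) * h1
        · by_cases hdb : d = b
          · subst hdb
            simp only [hab, hab.symm, if_true, if_false]
            linear_combination (-2 * ω a) * h1
          · simp [hda, hdb])
    convert h using 1
    simp only [hq, mul_sub, sum_sub_distrib, map_sub, map_mul, eval_X]
    simp
    ring
  obtain ⟨B, hB⟩ := q.exists_bound_eval_sphere
  have hcont : ∀ (r : MvPolynomial (Fin n) ℝ) t,
      Continuous fun ω : EuclideanSpace ℝ (Fin n) => eval (fun d => G t ω d) r := fun r t =>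
    r.continuous_eval_euclidean.comp (G t).continuous
  have hint : ∀ (r : MvPolynomial (Fin n) ℝ) t,
      ∫ ω, eval (fun d => G t ω d) r ∂σ = ∫ ω, eval (fun d => ω d) r ∂σ := fun r t =>
    (hinv (G t)).integral_comp (G t).toHomeomorph.measurableEmbedding
      (fun ω => eval (fun d => ω d) r)
  have hG1 : ∀ t, ∀ ω ∈ Metric.sphere (0 : EuclideanSpace ℝ (Fin n)) 1,
      G t ω ∈ Metric.sphere (0 : EuclideanSpace ℝ (Fin n)) 1 := by
    intro t ω hω
    simpa using hω
  have key := (hasDerivAt_integral_of_dominated_loc_of_deriv_le (μ := σ) (x₀ := (0 : ℝ))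
    (F := fun t (ω : EuclideanSpace ℝ (Fin n)) => eval (fun d => G t ω d) p)
    (F' := fun t (ω : EuclideanSpace ℝ (Fin n)) => 2 * eval (fun d => G t ω d) q)
    (s := Set.univ) (bound := fun _ => 2 * B) Filter.univ_mem
    (Filter.Eventually.of_forall fun t => (hcont p t).aestronglyMeasurable)
    ((hinv (G 0)).integrable_comp_of_integrable (p.integrable_eval hsupp))
    ((hcont q 0).const_mul 2).aestronglyMeasurable
    (by
      filter_upwards [ae_mem_sphere hsupp] with ω hω t _
      have := hB _ (hG1 t ω hω)
      rw [norm_mul]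
      simpa using this)
    (integrable_const _)
    (Filter.Eventually.of_forall fun ω t _ => hderiv ω t)).2
  simp only [hint, integral_const_mul] at key
  simpa using key.unique (hasDerivAt_const _ _)

/-- Integration by parts on the sphere, for a form of degree `k`. -/
lemma integral_pderiv_eq
    (hsupp : σ (Metric.sphere (0 : EuclideanSpace ℝ (Fin n)) 1)ᶜ = 0)
    (hinv : ∀ g : EuclideanSpace ℝ (Fin n) ≃ₗᵢ[ℝ] EuclideanSpace ℝ (Fin n),
      MeasurePreserving g σ σ)
    {p : MvPolynomial (Fin n) ℝ} {k : ℕ} (hp : p.IsHomogeneous k) (a : Fin n) :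
    ∫ ω, eval (fun d => ω d) (pderiv a p) ∂σ =
      (n + k - 1) * ∫ ω, eval (fun d => ω d) (X a * p) ∂σ := by
  have h0 : ∫ ω, eval (fun d => ω d)
      (∑ b, (X a * pderiv b (X b * p) - X b * pderiv a (X b * p))) ∂σ = 0 := by
    simp only [map_sum]
    rw [integral_finsetSum _ fun b _ => integrable_eval hsupp _]
    exact sum_eq_zero fun b _ => integral_infinitesimal_rotation_eq_zero hsupp hinv _ a b
  have h1 : (∑ b, (X a * pderiv b (X b * p) - X b * pderiv a (X b * p)))
      = C ((n + k - 1 : ℝ)) * (X a * p) - (∑ b, X b ^ 2) * pderiv a p := by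
    have e := hp.sum_X_mul_pderiv
    have : ∀ b, X a * pderiv b (X b * p) - X b * pderiv a (X b * p) =
      X a * p + X a * (X b * pderiv b p) - X b ^ 2 * pderiv a p
        - (if b = a then X b * p else 0) := by
      intro b
      simp only [pderiv_mul, pderiv_X, Pi.single_apply]
      split_ifs with h <;> simp_all <;> ring
    simp only [this, sum_sub_distrib, sum_add_distrib, ← mul_sum, ← sum_mul, e]
    simp
    ring
  have h2 : ∫ ω, eval (fun d => ω d)
      (C ((n + k - 1 : ℝ)) * (X a * p) - (∑ b, X b ^ 2) * pderiv a p) ∂σ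
    = ∫ ω, eval (fun d => ω d) (C ((n + k - 1 : ℝ)) * (X a * p) - pderiv a p) ∂σ := by
    refine integral_congr_ae ?_
    filter_upwards [ae_mem_sphere hsupp] with ω hω
    have : ∑ b, ω b ^ 2 = 1 := by
      have := EuclideanSpace.real_norm_sq_eq ω
      rw [mem_sphere_zero_iff_norm.1 hω] at this
      simpa using this.symm
    simp [this]
  rw [h1, h2] at h0
  have h3 : ∀ ω : EuclideanSpace ℝ (Fin n),
      eval (fun d => ω d) (C ((n + k - 1 : ℝ)) * (X a * p) - pderiv a p) =
      (n + k - 1) * eval (fun d => ω d) (X a * p) - eval (fun d => ω d) (pderiv a p) := by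
    intro ω
    rw [eval_sub, eval_mul, eval_C]
  simp only [h3] at h0
  rw [integral_sub ((integrable_eval hsupp _).const_mul _) (integrable_eval hsupp _),
    sub_eq_zero, integral_const_mul] at h0
  exact h0.symm

lemma MvPolynomial.pderiv_pderiv_comm (i j : Fin n) (p : MvPolynomial (Fin n) ℝ) :
    pderiv i (pderiv j p) = pderiv j (pderiv i p) := by
  induction p using MvPolynomial.induction_on with
  | C a => simp
  | add p q hp hq => simp [hp, hq]
  | mul_X p k hp =>
    simp only [pderiv_mul, map_add, hp, pderiv_X, Pi.single_apply, apply_ite, pderiv_one, map_zero]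
    split_ifs <;> (simp; try ring)

/-- A harmonic form is orthogonal on the sphere to forms of lower degree. -/
lemma integral_mul_harmonic_eq_zero (hn : 2 ≤ n)
    (hsupp : σ (Metric.sphere (0 : EuclideanSpace ℝ (Fin n)) 1)ᶜ = 0)
    (hinv : ∀ g : EuclideanSpace ℝ (Fin n) ≃ₗᵢ[ℝ] EuclideanSpace ℝ (Fin n),
      MeasurePreserving g σ σ)
    {j k : ℕ} {f g : MvPolynomial (Fin n) ℝ} (hjk : j < k) (hf : f.IsHomogeneous j)
    (hg : g.IsHomogeneous k) (hΔ : ∑ d, pderiv d (pderiv d g) = 0) :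
    ∫ ω, eval (fun d => ω d) (f * g) ∂σ = 0 := by
  induction j using Nat.strong_induction_on generalizing k f g with
  | _ j ih =>
  obtain ⟨k, rfl⟩ : ∃ m, k = m + 1 := ⟨k - 1, by omega⟩
  have h1 := sum_congr rfl fun a (_ : a ∈ univ) =>
    integral_pderiv_eq hsupp hinv (hf.mul (hg.pderiv (i := a))) a
  rw [← mul_sum, ← integral_finsetSum _ fun b _ => integrable_eval hsupp _,
    ← integral_finsetSum _ fun b _ => integrable_eval hsupp _] at h1
  simp only [← map_sum] at h1
  have h2 : ∑ a, X a * (f * pderiv a g) = C ((k + 1 : ℕ) : ℝ) * (f * g) := by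
    calc _ = f * ∑ a, X a * pderiv a g := by rw [mul_sum]; exact sum_congr rfl fun _ _ => by ring
      _ = _ := by rw [hg.sum_X_mul_pderiv]; simp; ring
  have h3 : ∑ a, pderiv a (f * pderiv a g) = ∑ a, pderiv a f * pderiv a g := by
    simp only [pderiv_mul, sum_add_distrib, ← mul_sum, hΔ, mul_zero, add_zero]
  have h4 : ∫ ω, eval (fun d => ω d) (∑ a, pderiv a f * pderiv a g) ∂σ = 0 := by
    simp only [map_sum]
    rw [integral_finsetSum _ fun b _ => integrable_eval hsupp _]
    refine sum_eq_zero fun a _ => ?_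
    rcases Nat.eq_zero_or_pos j with rfl | hj
    · obtain ⟨c, rfl⟩ : ∃ c, f = C c :=
        ⟨_, totalDegree_eq_zero_iff_eq_C.1 (Nat.le_zero.1 hf.totalDegree_le)⟩
      simp
    · refine ih (j - 1) (by omega) (k := k) (by omega) hf.pderiv (by simpa using hg.pderiv) ?_
      simp only [pderiv_pderiv_comm _ a, ← map_sum, hΔ, map_zero]
  have h5 : ∀ ω : EuclideanSpace ℝ (Fin n), eval (fun d => ω d) (C ((k + 1 : ℕ) : ℝ) * (f * g)) =
      ((k + 1 : ℕ) : ℝ) * eval (fun d => ω d) (f * g) := fun ω => by rw [eval_mul, eval_C]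
  rw [h2, h3, h4] at h1
  simp only [h5, integral_const_mul] at h1
  have hn' : (2 : ℝ) ≤ n := by exact_mod_cast hn
  rcases mul_eq_zero.1 h1.symm with h | h
  · rw [Nat.add_sub_cancel] at h
    push_cast at h
    linarith [(Nat.cast_nonneg k : (0 : ℝ) ≤ k), (Nat.cast_nonneg j : (0 : ℝ) ≤ j)]
  · exact (mul_eq_zero.1 h).resolve_left (by positivity)

end SphereIntegrals

section HarmonicDimension

open MvPolynomial

variable {n : ℕ}

lemma MvPolynomial.IsHomogeneous.eval_smul_real {p : MvPolynomial (Fin n) ℝ} {k : ℕ}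
    (hp : p.IsHomogeneous k) (c : ℝ) (x : Fin n → ℝ) :
    eval (fun d => c * x d) p = c ^ k * eval x p := by
  rw [eval_eq', eval_eq', mul_sum]
  refine sum_congr rfl fun m hm => ?_
  have hk : ∑ i, m i = k := by
    rw [← Finsupp.degree_eq_sum, Finsupp.degree_eq_weight_one]
    exact hp (mem_support_iff.1 hm)
  rw [← hk, ← prod_pow_eq_pow_sum]
  simp only [mul_pow, prod_mul_distrib]
  ring

lemma MvPolynomial.IsHomogeneous.eq_zero_of_eval_sphere (hn : 0 < n)
    {p : MvPolynomial (Fin n) ℝ} {k : ℕ} (hp : p.IsHomogeneous k)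
    (h : ∀ ω ∈ Metric.sphere (0 : EuclideanSpace ℝ (Fin n)) 1, eval (fun d => ω d) p = 0) :
    p = 0 := by
  suffices X (⟨0, hn⟩ : Fin n) * p = 0 from (mul_eq_zero.1 this).resolve_left (X_ne_zero _)
  refine MvPolynomial.funext fun x => ?_
  rw [map_mul, eval_X, map_zero]
  rcases eq_or_ne x 0 with rfl | hx
  · simp
  · have hy : WithLp.toLp 2 x ≠ 0 := by simpa using hx
    have h1 := h (‖WithLp.toLp 2 x‖⁻¹ • WithLp.toLp 2 x)
      (by rw [mem_sphere_zero_iff_norm, norm_smul, norm_inv, norm_norm,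
        inv_mul_cancel₀ (norm_ne_zero_iff.2 hy)])
    simp only [PiLp.smul_apply, smul_eq_mul] at h1
    rw [hp.eval_smul_real] at h1
    rw [(mul_eq_zero.1 h1).resolve_left (pow_ne_zero _ (inv_ne_zero (norm_ne_zero_iff.2 hy))),
      mul_zero]

lemma finrank_homogeneousSubmodule (hn : 0 < n) (k : ℕ) :
    Module.finrank ℝ (homogeneousSubmodule (Fin n) ℝ k) = (n + k - 1).choose (n - 1) := by
  rw [homogeneousSubmodule_eq_finsupp_supported]
  refine (Module.finrank_eq_nat_card_basis (basisRestrictSupport ℝ _)).trans ?_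
  have : {d : Fin n →₀ ℕ | d.degree = k} = (univ.finsuppAntidiag k : Finset (Fin n →₀ ℕ)) := by
    ext d
    simp [Finsupp.degree_eq_sum]
  rw [this, Nat.card_coe_set_eq, Set.ncard_coe_finset, card_finsuppAntidiag_nat_eq_choose,
    card_univ, Fintype.card_fin]
  exact Nat.choose_symm_of_eq_add (by omega)

/-- A spanning family of the spherical harmonics of degree `k` has at least
`dim P_k - dim P_{k-2}` members, where `P_k` is the space of forms of degree `k`. -/
lemma choose_le_card_harmonic_spanning (hn : 0 < n) {k m : ℕ} {e : Fin m → MvPolynomial (Fin n) ℝ}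
    (he : ∀ i, (e i).IsHomogeneous k)
    (hspan : ∀ p : MvPolynomial (Fin n) ℝ, p.IsHomogeneous k →
      ∑ d, pderiv d (pderiv d p) = 0 →
      ∃ a : Fin m → ℝ, ∀ ω ∈ Metric.sphere (0 : EuclideanSpace ℝ (Fin n)) 1,
        eval (fun d => ω d) p = ∑ i, a i * eval (fun d => ω d) (e i)) :
    (n + k - 1).choose (n - 1) ≤ m + if 2 ≤ k then (n + (k - 2) - 1).choose (n - 1) else 0 := by
  let L : MvPolynomial (Fin n) ℝ →ₗ[ℝ] MvPolynomial (Fin n) ℝ :=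
    ∑ d, (pderiv d).toLinearMap ∘ₗ (pderiv d).toLinearMap
  have hL : ∀ p, L p = ∑ d, pderiv d (pderiv d p) := fun p => by simp [L]
  have hfin : ∀ j, Module.Finite ℝ (homogeneousSubmodule (Fin n) ℝ j) := fun j =>
    Module.Finite.iff_fg.2 (homogeneousSubmodule_fg _ _ j)
  have := hfin k
  let f := L.domRestrict (homogeneousSubmodule (Fin n) ℝ k)
  have hrank := f.finrank_range_add_finrank_ker
  have hker : Module.finrank ℝ (LinearMap.ker f) ≤ m := by
    rw [(Submodule.equivMapOfInjective _ (Submodule.subtype_injective _)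
      (LinearMap.ker f)).finrank_eq]
    have hle : (LinearMap.ker f).map (Submodule.subtype _) ≤ Submodule.span ℝ (Set.range e) := by
      rintro _ ⟨⟨p, hp⟩, hpf, rfl⟩
      obtain ⟨a, ha⟩ := hspan p hp (by rw [← hL]; exact hpf)
      have : p = ∑ i, a i • e i := by
        rw [← sub_eq_zero]
        refine IsHomogeneous.eq_zero_of_eval_sphere (k := k) hn ?_ fun ω hω => ?_
        · exact (homogeneousSubmodule (Fin n) ℝ k).sub_mem hp
            (Submodule.sum_mem _ fun i _ => Submodule.smul_mem _ _ (he i))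
        · simp [map_sub, map_sum, smul_eval, ha ω hω]
      change p ∈ _
      rw [this]
      exact Submodule.sum_mem (Submodule.span ℝ (Set.range e)) fun i _ =>
        Submodule.smul_mem _ (a i) (Submodule.subset_span ⟨i, rfl⟩)
    have : Module.Finite ℝ (Submodule.span ℝ (Set.range e)) :=
      Module.Finite.span_of_finite ℝ (Set.finite_range e)
    exact (Submodule.finrank_mono hle).trans ((finrank_range_le_card e).trans (by simp))
  have hrange : Module.finrank ℝ (LinearMap.range f) ≤
      if 2 ≤ k then (n + (k - 2) - 1).choose (n - 1) else 0 := by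
    split_ifs with hk
    · rw [← finrank_homogeneousSubmodule hn]
      have := hfin (k - 2)
      refine Submodule.finrank_mono ?_
      rintro _ ⟨⟨p, hp⟩, rfl⟩
      change L p ∈ _
      rw [hL]
      exact Submodule.sum_mem _ fun d _ =>
        IsHomogeneous.pderiv (IsHomogeneous.pderiv (n := k) hp)
    · have : LinearMap.range f = ⊥ := by
        rw [LinearMap.range_eq_bot]
        ext1 ⟨p, hp⟩
        change L p = 0
        rw [hL]
        refine sum_eq_zero fun d _ => ?_
        have h0 := IsHomogeneous.pderiv (i := d) (n := k) hp
        rw [show k - 1 = 0 by omega] at h0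
        rw [totalDegree_eq_zero_iff_eq_C.1 (Nat.le_zero.1 h0.totalDegree_le), pderiv_C]
      simp [this]
  rw [finrank_homogeneousSubmodule hn] at hrank
  omega

/-- Restriction of a polynomial to a unit circle, as a polynomial in the first coordinate plus the
second coordinate times such a polynomial. -/
lemma MvPolynomial.exists_eval_circle_eq (u v : Fin n → ℝ) {k : ℕ} (p : MvPolynomial (Fin n) ℝ)
    (hp : p.totalDegree ≤ k) :
    ∃ A B : Polynomial ℝ, (∀ i, k < i → A.coeff i = 0) ∧ (∀ i, k ≤ i → B.coeff i = 0) ∧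
      ∀ t s : ℝ, t ^ 2 + s ^ 2 = 1 →
        eval (fun d => t * u d + s * v d) p = A.eval t + s * B.eval t := by
  have hmon : ∀ (k : ℕ) (m : Fin n →₀ ℕ), m.degree = k →
      ∃ A B : Polynomial ℝ, (∀ i, k < i → A.coeff i = 0) ∧ (∀ i, k ≤ i → B.coeff i = 0) ∧
        ∀ t s : ℝ, t ^ 2 + s ^ 2 = 1 →
          ∏ d, (t * u d + s * v d) ^ m d = A.eval t + s * B.eval t := by
    intro k
    induction k with
    | zero =>
      intro m hm
      rw [Finsupp.degree_eq_zero_iff] at hm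
      subst hm
      exact ⟨1, 0, fun i hi => by rw [Polynomial.coeff_one, if_neg (by omega)], by simp, by simp⟩
    | succ k ih =>
      intro m hm
      obtain ⟨d, hd⟩ : ∃ d, m d ≠ 0 := by
        by_contra! h
        have : m = 0 := Finsupp.ext h
        simp [this] at hm
      have hm' : m - Finsupp.single d 1 + Finsupp.single d 1 = m :=
        tsub_add_cancel_of_le (Finsupp.single_le_iff.2 (Nat.one_le_iff_ne_zero.2 hd))
      obtain ⟨A, B, hA, hB, hAB⟩ := ih (m - Finsupp.single d 1) (by
        rw [← hm', map_add, Finsupp.degree_single] at hm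
        omega)
      refine ⟨Polynomial.C (u d) * (Polynomial.X ^ 1 * A) +
          Polynomial.C (v d) * (B - Polynomial.X ^ 2 * B),
        Polynomial.C (u d) * (Polynomial.X ^ 1 * B) + Polynomial.C (v d) * A, ?_, ?_, ?_⟩
      · intro i hi
        simp only [Polynomial.coeff_add, Polynomial.coeff_sub, Polynomial.coeff_C_mul,
          Polynomial.coeff_X_pow_mul']
        rw [hA _ (by omega), hB _ (by omega), hB _ (by omega)]
        simp
      · intro i hi
        simp only [Polynomial.coeff_add, Polynomial.coeff_C_mul, Polynomial.coeff_X_pow_mul']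
        rw [hA _ (by omega), hB _ (by omega)]
        simp
      · intro t s hts
        rw [← hm']
        simp only [Finsupp.add_apply, pow_add, prod_mul_distrib, hAB t s hts]
        have : ∏ x, (t * u x + s * v x) ^ (Finsupp.single d 1 x) = t * u d + s * v d := by
          rw [prod_eq_single d (fun b _ hb => by rw [Finsupp.single_eq_of_ne hb, pow_zero])
            (by simp)]
          simp
        rw [this]
        simp only [Polynomial.eval_add, Polynomial.eval_mul, Polynomial.eval_C, Polynomial.eval_sub,
          Polynomial.eval_pow, Polynomial.eval_X]
        linear_combination (B.eval t * v d) * hts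
  choose A B hA hB hAB using fun m => hmon _ m rfl
  have hk : ∀ m ∈ p.support, m.degree ≤ k := fun m hm => (le_totalDegree hm).trans hp
  refine ⟨∑ m ∈ p.support, Polynomial.C (coeff m p) * A m,
    ∑ m ∈ p.support, Polynomial.C (coeff m p) * B m, ?_, ?_, ?_⟩
  · intro i hi
    rw [Polynomial.finsetSum_coeff]
    exact sum_eq_zero fun m hm => by
      rw [Polynomial.coeff_C_mul, hA m i (by have := hk m hm; omega), mul_zero]
  · intro i hi
    rw [Polynomial.finsetSum_coeff]
    exact sum_eq_zero fun m hm => by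
      rw [Polynomial.coeff_C_mul, hB m i (by have := hk m hm; omega), mul_zero]
  · intro t s hts
    rw [eval_eq', Polynomial.eval_finsetSum, Polynomial.eval_finsetSum, mul_sum,
      ← sum_add_distrib]
    refine sum_congr rfl fun m _ => ?_
    rw [hAB m t s hts, Polynomial.eval_mul, Polynomial.eval_mul, Polynomial.eval_C]
    ring

/-- The zonal polynomial of a kernel built from forms of degree `j` has degree at most `j`. -/
lemma natDegree_le_of_eval_inner_eq (hn : 2 ≤ n) {j m : ℕ} {e : Fin m → MvPolynomial (Fin n) ℝ}
    (he : ∀ i, (e i).IsHomogeneous j) {q : Polynomial ℝ}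
    (hq : ∀ ω ∈ Metric.sphere (0 : EuclideanSpace ℝ (Fin n)) 1,
      ∀ ω' ∈ Metric.sphere (0 : EuclideanSpace ℝ (Fin n)) 1,
        ∑ i, eval (fun d => ω d) (e i) * eval (fun d => ω' d) (e i) = q.eval ⟪ω, ω'⟫) :
    q.natDegree ≤ j := by
  let u : EuclideanSpace ℝ (Fin n) := EuclideanSpace.single ⟨0, by omega⟩ 1
  let v : EuclideanSpace ℝ (Fin n) := EuclideanSpace.single ⟨1, by omega⟩ 1
  have huv : ⟪u, v⟫ = 0 := by simp [u, v, EuclideanSpace.inner_single_left]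
  have hu : ‖u‖ = 1 := by simp [u]
  have hv : ‖v‖ = 1 := by simp [v]
  have hvu : ⟪v, u⟫ = 0 := by rw [real_inner_comm, huv]
  let p : MvPolynomial (Fin n) ℝ := ∑ i, C (eval (fun d => u d) (e i)) * e i
  have hp : p.totalDegree ≤ j := totalDegree_finsetSum_le fun i _ =>
    (totalDegree_mul _ _).trans (by simpa using (he i).totalDegree_le)
  obtain ⟨A, B, hA, -, hAB⟩ := p.exists_eval_circle_eq (fun d => u d) (fun d => v d) hp
  have key : ∀ t s : ℝ, t ^ 2 + s ^ 2 = 1 → q.eval t = A.eval t + s * B.eval t := by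
    intro t s hts
    have hω : ‖t • u + s • v‖ = 1 := by
      have : ‖t • u + s • v‖ ^ 2 = 1 := by
        rw [← real_inner_self_eq_norm_sq]
        simp only [inner_add_left, inner_add_right, real_inner_smul_left, real_inner_smul_right,
          huv, hvu, real_inner_self_eq_norm_sq, norm_smul, hu, hv, mul_one, Real.norm_eq_abs,
          sq_abs]
        linarith
      exact (pow_eq_one_iff_of_nonneg (norm_nonneg _) two_ne_zero).1 this
    have h := hq (t • u + s • v) (by simpa using hω) u (by simpa using hu)
    rw [inner_add_left, real_inner_smul_left, real_inner_smul_left, hvu,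
      real_inner_self_eq_norm_sq, hu] at h
    rw [← hAB t s hts]
    simp only [p, map_sum, map_mul, eval_C]
    rw [show q.eval t = q.eval (t * 1 ^ 2 + s * 0) by simp, ← h]
    exact sum_congr rfl fun i _ => by simp [mul_comm]
  have hqA : q = A := by
    refine Polynomial.eq_of_infinite_eval_eq _ _ ((Set.Icc_infinite (zero_lt_one' ℝ)).mono ?_)
    intro t ht
    have hs : √(1 - t ^ 2) ^ 2 = 1 - t ^ 2 := Real.sq_sqrt (by nlinarith [ht.1, ht.2])
    have h1 := key t √(1 - t ^ 2) (by rw [hs]; ring)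
    have h2 := key t (-√(1 - t ^ 2)) (by rw [neg_sq, hs]; ring)
    change q.eval t = A.eval t
    linarith
  rw [hqA, Polynomial.natDegree_le_iff_coeff_eq_zero]
  exact hA

end HarmonicDimension

open MvPolynomial in
/-- A harmonic form is orthogonal on the sphere to all polynomials of lower degree. -/
lemma integral_mul_harmonic_eq_zero_of_totalDegree_lt {n : ℕ} (hn : 2 ≤ n)
    {σ : Measure (EuclideanSpace ℝ (Fin n))} [IsProbabilityMeasure σ]
    (hsupp : σ (Metric.sphere (0 : EuclideanSpace ℝ (Fin n)) 1)ᶜ = 0)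
    (hinv : ∀ g : EuclideanSpace ℝ (Fin n) ≃ₗᵢ[ℝ] EuclideanSpace ℝ (Fin n),
      MeasurePreserving g σ σ)
    {k : ℕ} {f g : MvPolynomial (Fin n) ℝ} (hf : f.totalDegree < k)
    (hg : g.IsHomogeneous k) (hΔ : ∑ d, pderiv d (pderiv d g) = 0) :
    ∫ ω, eval (fun d => ω d) (f * g) ∂σ = 0 := by
  rw [← sum_homogeneousComponent f, sum_mul]
  simp only [map_sum]
  rw [integral_finsetSum _ fun i _ => integrable_eval hsupp _]
  refine sum_eq_zero fun i hi => integral_mul_harmonic_eq_zero hn hsupp hinv ?_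
    (homogeneousComponent_isHomogeneous i f) hg hΔ
  have := mem_range.1 hi
  omega

lemma choose_add_choose_le_sum (n : ℕ) (hn : 2 ≤ n) (m : ℕ → ℕ)
    (h : ∀ k, (n + k - 1).choose (n - 1) ≤
      m k + if 2 ≤ k then (n + (k - 2) - 1).choose (n - 1) else 0) (l : ℕ) :
    (n + l - 1).choose (n - 1) + (n + l - 2).choose (n - 1) ≤ ∑ j ∈ range (l + 1), m j := by
  induction l using Nat.twoStepInduction with
  | zero =>
    have h0 := h 0
    rw [Nat.choose_eq_zero_of_lt (by omega : n + 0 - 2 < n - 1)]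
    simpa using h0
  | one =>
    have h0 := h 0
    have h1 := h 1
    simp only [sum_range_succ, sum_range_zero]
    simp only [show n + 1 - 2 = n + 0 - 1 by omega]
    simp at h0 h1 ⊢
    omega
  | more l ih _ =>
    have h1 := h (l + 1)
    have h2 := h (l + 2)
    rw [sum_range_succ, sum_range_succ]
    rw [if_pos (by omega), show l + 2 - 2 = l by omega] at h2
    rw [show n + (l + 2) - 2 = n + (l + 1) - 1 by omega]
    split_ifs at h1 with hl
    · rw [show n + (l + 1 - 2) - 1 = n + l - 2 by omega] at h1
      omega
    · omega

/-- A rectangular matrix with orthogonal columns of squared length `N ≠ 0` and at least as many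
columns as rows also has orthogonal rows. -/
lemma Matrix.mul_transpose_eq_smul_one {α ι : Type*} [Fintype α] [Fintype ι] [DecidableEq α]
    [DecidableEq ι] {A : Matrix α ι ℝ} {N : ℝ} (hN : N ≠ 0) (h : A.transpose * A = N • 1)
    (hcard : Fintype.card α ≤ Fintype.card ι) : A * A.transpose = N • 1 := by
  have h1 : (N⁻¹ • A.transpose) * A = 1 := by rw [Matrix.smul_mul, h, inv_smul_smul₀ hN]
  have hle : Fintype.card ι ≤ Fintype.card α := by
    rw [← Matrix.rank_one (R := ℝ) (n := ι), ← h1]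
    exact (Matrix.rank_mul_le_right _ _).trans (Matrix.rank_le_card_height _)
  rw [Matrix.mul_eq_one_comm_of_card_eq _ _ _ (hle.antisymm hcard), Matrix.mul_smul] at h1
  rw [← h1, smul_inv_smul₀ hN]

/-- for a tight spherical `2l`-design `X ⊆ 𝕊^{n-1}`, the set `A_X` of inner
products of distinct points of `X` coincides with the set of real roots of
`R^{(l)} = ∑_{j=0}^{l} Q^{(j)}`, where `Q^{(j)}` is the (Gegenbauer) polynomial giving the
reproducing kernel of `H^{(j)}(𝕊^{n-1})` via `∑_i e_i(ω)e_i(ω') = Q^{(j)}(⟪ω,ω'⟫)` for any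
orthonormal basis `(e_i)` of `H^{(j)}(𝕊^{n-1})`. -/
theorem tight_even_design_inner_products_eq_roots
    (n l : ℕ) (hn : 2 ≤ n)
    (σ : Measure (EuclideanSpace ℝ (Fin n))) [IsProbabilityMeasure σ]
    (hsupp : σ (Metric.sphere (0 : EuclideanSpace ℝ (Fin n)) 1)ᶜ = 0)
    (hinv : ∀ g : EuclideanSpace ℝ (Fin n) ≃ₗᵢ[ℝ] EuclideanSpace ℝ (Fin n),
      MeasurePreserving g σ σ)
    (Q : ℕ → Polynomial ℝ)
    (hQ : ∀ j : ℕ, ∃ (m : ℕ) (e : Fin m → MvPolynomial (Fin n) ℝ),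
      (∀ i, (e i).IsHomogeneous j) ∧
      (∀ i, (∑ d : Fin n, MvPolynomial.pderiv d (MvPolynomial.pderiv d (e i))) = 0) ∧
      (∀ i i' : Fin m,
        ∫ ω, MvPolynomial.eval (fun d => ω d) (e i)
            * MvPolynomial.eval (fun d => ω d) (e i') ∂σ
          = if i = i' then 1 else 0) ∧
      (∀ p : MvPolynomial (Fin n) ℝ, p.IsHomogeneous j →
        (∑ d : Fin n, MvPolynomial.pderiv d (MvPolynomial.pderiv d p)) = 0 →
        ∃ a : Fin m → ℝ, ∀ ω ∈ Metric.sphere (0 : EuclideanSpace ℝ (Fin n)) 1,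
          MvPolynomial.eval (fun d => ω d) p
            = ∑ i, a i * MvPolynomial.eval (fun d => ω d) (e i)) ∧
      (∀ ω ∈ Metric.sphere (0 : EuclideanSpace ℝ (Fin n)) 1,
        ∀ ω' ∈ Metric.sphere (0 : EuclideanSpace ℝ (Fin n)) 1,
          ∑ i, MvPolynomial.eval (fun d => ω d) (e i)
              * MvPolynomial.eval (fun d => ω' d) (e i)
            = Polynomial.eval (⟪ω, ω'⟫) (Q j)))
    (X : Finset (EuclideanSpace ℝ (Fin n))) (hX : X.Nonempty)
    (hXs : ∀ x ∈ X, x ∈ Metric.sphere (0 : EuclideanSpace ℝ (Fin n)) 1)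
    (hdesign : ∀ p : MvPolynomial (Fin n) ℝ, p.totalDegree ≤ 2 * l →
      (X.card : ℝ)⁻¹ * ∑ x ∈ X, MvPolynomial.eval (fun i => x i) p
        = ∫ ω, MvPolynomial.eval (fun i => ω i) p ∂σ)
    (htight : X.card = Nat.choose (n + l - 1) (n - 1) + Nat.choose (n + l - 2) (n - 1)) :
    {c : ℝ | c ∈ Set.Ico (-1 : ℝ) 1 ∧ ∃ x ∈ X, ∃ y ∈ X, x ≠ y ∧ ⟪x, y⟫ = c}
      = {c : ℝ | Polynomial.eval c (∑ j ∈ Finset.range (l + 1), Q j) = 0} := by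
  classical
  choose m e he hΔ hortho hspan hker using hQ
  have hm k := choose_le_card_harmonic_spanning (by omega) (he k) (hspan k)
  have hN : (X.card : ℝ) ≠ 0 := by simpa using hX.ne_empty
  have hnorm : ∀ x ∈ X, ‖x‖ = 1 := fun x hx => mem_sphere_zero_iff_norm.1 (hXs x hx)
  have hsum : ∀ p : MvPolynomial (Fin n) ℝ, p.totalDegree ≤ 2 * l →
      ∑ x ∈ X, MvPolynomial.eval (fun i => x i) p
        = X.card * ∫ ω, MvPolynomial.eval (fun i => ω i) p ∂σ := fun p hp => by
    rw [← hdesign p hp, mul_inv_cancel_left₀ hN]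
  set R := ∑ j ∈ Finset.range (l + 1), Q j with hR
  let ι := Σ j : Fin (l + 1), Fin (m j)
  let A : Matrix X ι ℝ := Matrix.of fun x i => MvPolynomial.eval (fun d => x.1 d) (e i.1 i.2)
  have hAA : A.transpose * A = (X.card : ℝ) • 1 := by
    ext ⟨j, i⟩ ⟨j', i'⟩
    simp only [Matrix.mul_apply, Matrix.transpose_apply, A, Matrix.of_apply, ← map_mul,
      Matrix.smul_apply, Matrix.one_apply, smul_eq_mul]
    rw [univ_eq_attach, sum_attach X (fun x => MvPolynomial.eval (fun d => x d) (e j i * e j' i')),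
      hsum _ ((MvPolynomial.totalDegree_mul _ _).trans (by
        have h1 := (he j i).totalDegree_le
        have h2 := (he j' i').totalDegree_le
        omega))]
    congr 1
    rcases lt_trichotomy j j' with h | rfl | h
    · rw [integral_mul_harmonic_eq_zero hn hsupp hinv h (he j i) (he j' i') (hΔ j' i'), if_neg]
      rintro ⟨⟩
      exact h.ne rfl
    · simp only [map_mul, hortho, Sigma.mk.injEq, heq_eq_eq, true_and]
    · rw [mul_comm,
        integral_mul_harmonic_eq_zero hn hsupp hinv h (he j' i') (he j i) (hΔ j i), if_neg]
      rintro ⟨⟩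
      exact h.ne rfl
  have hcard : Fintype.card X ≤ Fintype.card ι := by
    simp only [ι, Fintype.card_sigma, Fintype.card_fin, Fintype.card_coe]
    rw [Fin.sum_univ_eq_sum_range m, htight]
    exact choose_add_choose_le_sum n hn m hm l
  have hReval : ∀ x ∈ X, ∀ y ∈ X, R.eval ⟪x, y⟫ = if x = y then (X.card : ℝ) else 0 := by
    intro x hx y hy
    have h := congrFun (congrFun (Matrix.mul_transpose_eq_smul_one hN hAA hcard) ⟨x, hx⟩) ⟨y, hy⟩
    simp only [Matrix.mul_apply, Matrix.transpose_apply, A, Matrix.of_apply, Matrix.smul_apply,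
      Matrix.one_apply, smul_eq_mul, Subtype.mk.injEq, mul_ite, mul_one, mul_zero] at h
    rw [← h, hR, Polynomial.eval_finsetSum, Fintype.sum_sigma,
      ← Fin.sum_univ_eq_sum_range fun j => (Q j).eval ⟪x, y⟫]
    exact sum_congr rfl fun j _ => (hker j x (hXs x hx) y (hXs y hy)).symm
  have hRdeg : R.natDegree ≤ l := Polynomial.natDegree_sum_le_of_forall_le _ _ fun j hj =>
    (natDegree_le_of_eval_inner_eq hn (he j) (hker j)).trans (by have := mem_range.1 hj; omega)
  have hR0 : R ≠ 0 := by
    obtain ⟨x, hx⟩ := hX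
    intro h
    have := hReval x hx x hx
    rw [h, if_pos rfl, Polynomial.eval_zero] at this
    exact hN this.symm
  have hlt : ∀ x ∈ X, ∀ y ∈ X, x ≠ y → ⟪x, y⟫ < (1 : ℝ) := fun x hx y hy hxy =>
    (inner_lt_one_iff_real_of_norm_eq_one (hnorm x hx) (hnorm y hy)).2 hxy
  let S : Finset ℝ := X.offDiag.image fun z => ⟪z.1, z.2⟫
  have hS : ∀ c, c ∈ S ↔ ∃ x ∈ X, ∃ y ∈ X, x ≠ y ∧ ⟪x, y⟫ = c := by
    intro c
    simp only [S, mem_image, mem_offDiag, Prod.exists]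
    constructor
    · rintro ⟨x, y, ⟨hx, hy, hxy⟩, h⟩
      exact ⟨x, hx, y, hy, hxy, h⟩
    · rintro ⟨x, hx, y, hy, hxy, h⟩
      exact ⟨x, y, ⟨hx, hy, hxy⟩, h⟩
  have hScard : l ≤ S.card := by
    by_contra! hSl
    have hml : 0 < m l := by
      have h := hm l
      obtain ⟨k, rfl⟩ : ∃ k, n = k + 2 := ⟨n - 2, by omega⟩
      rw [show k + 2 + l - 1 = k + l + 1 by omega, show k + 2 - 1 = k + 1 by omega,
        Nat.choose_succ_succ'] at h
      have h1 : (k + 2 + (l - 2) - 1).choose (k + 1) ≤ (k + l).choose (k + 1) ∨ ¬ 2 ≤ l := by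
        by_cases h2 : 2 ≤ l
        · exact Or.inl (Nat.choose_mono _ (by omega))
        · exact Or.inr h2
      have h2 : 0 < (k + l).choose k := Nat.choose_pos (by omega)
      split_ifs at h <;> omega
    set g := e l ⟨0, hml⟩ with hg
    have hgl : g.totalDegree ≤ l := (he l ⟨0, hml⟩).totalDegree_le
    have hgX : ∀ x ∈ X, MvPolynomial.eval (fun d => x d) g = 0 := by
      intro x hx
      let f : MvPolynomial (Fin n) ℝ :=
        ∏ c ∈ S, (∑ d, MvPolynomial.C (x d) * MvPolynomial.X d - MvPolynomial.C c)
      have hfeval : ∀ y : EuclideanSpace ℝ (Fin n),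
          MvPolynomial.eval (fun d => y d) f = ∏ c ∈ S, (⟪y, x⟫ - c) := by
        intro y
        simp [f, PiLp.inner_apply]
      have hf : f.totalDegree < l := by
        refine lt_of_le_of_lt ((MvPolynomial.totalDegree_finsetProd _ _).trans
          (sum_le_card_nsmul _ _ 1 fun c _ => ?_)) (by simpa using hSl)
        refine (MvPolynomial.totalDegree_sub_C_le _ _).trans
          (MvPolynomial.totalDegree_finsetSum_le fun d _ =>
            (MvPolynomial.totalDegree_mul _ _).trans (by simp))
      have h0 := hsum (f * g) ((MvPolynomial.totalDegree_mul _ _).trans (by omega))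
      rw [integral_mul_harmonic_eq_zero_of_totalDegree_lt hn hsupp hinv hf (he l _) (hΔ l _),
        mul_zero, sum_eq_single_of_mem x hx, map_mul, hfeval] at h0
      · refine (mul_eq_zero.1 h0).resolve_left (prod_ne_zero_iff.2 fun c hc => ?_)
        obtain ⟨y, hy, z, hz, hyz, rfl⟩ := (hS c).1 hc
        rw [real_inner_self_eq_norm_sq, hnorm x hx]
        have := hlt y hy z hz hyz
        linarith
      · intro y hy hyx
        rw [map_mul, hfeval, prod_eq_zero ((hS ⟪y, x⟫).2 ⟨y, hy, x, hx, hyx, rfl⟩) (sub_self _),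
          zero_mul]
    have h1 := hsum (g * g) ((MvPolynomial.totalDegree_mul _ _).trans (by omega))
    rw [sum_eq_zero fun x hx => by rw [map_mul, hgX x hx, zero_mul]] at h1
    simp only [map_mul, hg, hortho, if_true, mul_one] at h1
    exact hN h1.symm
  have hSR : S = R.roots.toFinset := by
    refine eq_of_subset_of_card_le (fun c hc => ?_)
      ((Multiset.toFinset_card_le _).trans ((R.card_roots').trans (hRdeg.trans hScard)))
    obtain ⟨x, hx, y, hy, hxy, rfl⟩ := (hS c).1 hc
    rw [Multiset.mem_toFinset, Polynomial.mem_roots hR0, Polynomial.IsRoot.def, hReval x hx y hy,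
      if_neg hxy]
  ext c
  have hroot : R.eval c = 0 ↔ c ∈ S := by
    rw [hSR, Multiset.mem_toFinset, Polynomial.mem_roots hR0, Polynomial.IsRoot.def]
  rw [Set.mem_ofPred_eq, Set.mem_ofPred_eq, hroot, hS]
  refine ⟨And.right, fun h => ⟨?_, h⟩⟩
  obtain ⟨x, hx, y, hy, hxy, rfl⟩ := h
  refine ⟨?_, hlt x hx y hy hxy⟩
  have := neg_le_of_abs_le (abs_real_inner_le_norm x y)
  simpa [hnorm x hx, hnorm y hy] using this
end

section
/- Let n ≥ 2 and l ≥ 0 be integers, and let (X,W) be an antipodal cubature formula of strength 2l+1 on 𝕊^{n-1} (X = −X, W(−x) = W(x)) which is tight, i.e. |X| = 2·C(n+l−1, n−1). Then the weight W is uniform (W(x) = 1/|X| for all x ∈ X, so X is a tight spherical (2l+1)-design), and the set B_X = {c ∈ (−1,1) : c = ⟨x,y⟩ for some x,y ∈ X with x ≠ ±y} coincides with the set of real roots of the polynomial C^{(l)} = ∑_{0 ≤ j ≤ ⌊l/2⌋} Q^{(l−2j)}. -/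
open MeasureTheory Finset
open scoped RealInnerProductSpace

namespace SphericalCubature

open MvPolynomial in
/-- The Laplacian on real polynomials in `n` variables. -/
noncomputable def laplacian (n : ℕ) : MvPolynomial (Fin n) ℝ →ₗ[ℝ] MvPolynomial (Fin n) ℝ :=
  ∑ d, (pderiv d).toLinearMap ∘ₗ (pderiv d).toLinearMap

open MvPolynomial in
/-- The squared Euclidean norm, as a polynomial. -/
noncomputable def normSqPoly (n : ℕ) : MvPolynomial (Fin n) ℝ := ∑ d, X d ^ 2

section Harmonic

open MvPolynomial

variable {n : ℕ}

lemma laplacian_apply (p : MvPolynomial (Fin n) ℝ) :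
    laplacian n p = ∑ d, pderiv d (pderiv d p) := by
  simp [laplacian]

lemma isHomogeneous_normSqPoly : (normSqPoly n).IsHomogeneous 2 :=
  IsHomogeneous.sum _ _ _ fun d _ => isHomogeneous_X_pow d 2

lemma isHomogeneous_laplacian {p : MvPolynomial (Fin n) ℝ} {m : ℕ} (hp : p.IsHomogeneous m) :
    (laplacian n p).IsHomogeneous (m - 2) := by
  rw [laplacian_apply]
  exact IsHomogeneous.sum _ _ _ fun d _ => hp.pderiv.pderiv

lemma laplacian_eq_zero_of_lt_two {p : MvPolynomial (Fin n) ℝ} {m : ℕ} (hp : p.IsHomogeneous m)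
    (hm : m < 2) : laplacian n p = 0 := by
  rw [laplacian_apply]
  refine Finset.sum_eq_zero fun d _ => ?_
  have h : (pderiv d p).IsHomogeneous 0 := by
    have := hp.pderiv (i := d)
    rwa [show m - 1 = 0 by omega] at this
  rw [← totalDegree_zero_iff_isHomogeneous, totalDegree_eq_zero_iff_eq_C] at h
  rw [h, pderiv_C]

lemma eval_normSqPoly (x : EuclideanSpace ℝ (Fin n)) :
    eval (fun d => x d) (normSqPoly n) = ‖x‖ ^ 2 := by
  simp [normSqPoly, EuclideanSpace.real_norm_sq_eq]

lemma normSqPoly_ne_zero (hn : n ≠ 0) : normSqPoly n ≠ 0 := by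
  intro h
  have h1 := congrArg (eval fun _ => (1 : ℝ)) h
  simp [normSqPoly] at h1
  exact hn h1

lemma laplacian_normSqPoly_mul {q : MvPolynomial (Fin n) ℝ} {m : ℕ} (hq : q.IsHomogeneous m) :
    laplacian n (normSqPoly n * q) =
      normSqPoly n * laplacian n q + ((2 * n + 4 * m : ℕ) : ℝ) • q := by
  have hd (d : Fin n) : pderiv d (normSqPoly n) = 2 * X d := by
    simp only [normSqPoly, map_sum, pderiv_pow, pderiv_X]
    rw [Finset.sum_eq_single d]
    · simp
    · intro b _ hb
      simp [hb.symm]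
    · simp
  have h2 (d : Fin n) : pderiv d (2 : MvPolynomial (Fin n) ℝ) = 0 := by
    rw [← map_ofNat C 2, pderiv_C]
  have key (d : Fin n) : pderiv d (pderiv d (normSqPoly n * q)) =
      2 * q + 4 * (X d * pderiv d q) + normSqPoly n * pderiv d (pderiv d q) := by
    simp only [pderiv_mul, map_add, hd, h2, pderiv_X_self]
    ring
  rw [laplacian_apply, laplacian_apply]
  simp only [key, Finset.sum_add_distrib, ← Finset.mul_sum, hq.sum_X_mul_pderiv]
  simp only [sum_const, card_univ, Fintype.card_fin, nsmul_eq_mul, smul_eq_C_mul, map_natCast]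
  push_cast
  ring

/-- A homogeneous polynomial with `|x|² Δq = -c q` and `c > 0` vanishes. -/
lemma eq_zero_of_normSqPoly_mul_laplacian (m : ℕ) : ∀ (q : MvPolynomial (Fin n) ℝ) (c : ℝ),
    q.IsHomogeneous m → 0 < c → normSqPoly n * laplacian n q = -c • q → q = 0 := by
  induction m using Nat.strong_induction_on with
  | _ m ih =>
    intro q c hq hc h
    have hlap : laplacian n q = 0 := by
      rcases lt_or_ge m 2 with hm | hm
      · exact laplacian_eq_zero_of_lt_two hq hm
      · have h1 := congrArg (laplacian n) h
        rw [laplacian_normSqPoly_mul (isHomogeneous_laplacian hq), map_smul] at h1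
        refine ih (m - 2) (by omega) _ (c + ((2 * n + 4 * (m - 2) : ℕ) : ℝ))
          (isHomogeneous_laplacian hq) (by positivity) ?_
        rw [eq_sub_of_add_eq h1]
        module
    rw [hlap, mul_zero] at h
    exact (smul_eq_zero.mp h.symm).resolve_left (by linarith)

lemma eq_zero_of_laplacian_normSqPoly_mul_eq_zero (hn : n ≠ 0) {q : MvPolynomial (Fin n) ℝ}
    {m : ℕ} (hq : q.IsHomogeneous m) (h : laplacian n (normSqPoly n * q) = 0) : q = 0 := by
  rw [laplacian_normSqPoly_mul hq] at h
  refine eq_zero_of_normSqPoly_mul_laplacian m q ((2 * n + 4 * m : ℕ) : ℝ) hq ?_ ?_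
  · have : 0 < n := Nat.pos_of_ne_zero hn
    exact_mod_cast (by omega)
  · rw [eq_neg_of_add_eq_zero_left h, neg_smul]

/-- Fischer decomposition, one step. -/
lemma exists_harmonic_add_normSqPoly_mul (hn : n ≠ 0) {m : ℕ} {p : MvPolynomial (Fin n) ℝ}
    (hp : p.IsHomogeneous (m + 2)) :
    ∃ h q : MvPolynomial (Fin n) ℝ, h.IsHomogeneous (m + 2) ∧ laplacian n h = 0 ∧
      q.IsHomogeneous m ∧ p = h + normSqPoly n * q := by
  have hmul {q : MvPolynomial (Fin n) ℝ} (hq : q.IsHomogeneous m) :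
      (normSqPoly n * q).IsHomogeneous (m + 2) := by
    rw [add_comm]
    exact isHomogeneous_normSqPoly.mul hq
  have : FiniteDimensional ℝ (homogeneousSubmodule (Fin n) ℝ m) :=
    Module.Finite.iff_fg.mpr (homogeneousSubmodule_fg _ _ m)
  let T : homogeneousSubmodule (Fin n) ℝ m →ₗ[ℝ] homogeneousSubmodule (Fin n) ℝ m :=
    ((laplacian n ∘ₗ LinearMap.mulLeft ℝ (normSqPoly n)).restrict
      (p := homogeneousSubmodule (Fin n) ℝ m) (q := homogeneousSubmodule (Fin n) ℝ m)
      fun q hq => isHomogeneous_laplacian (hmul hq))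
  have hT : Function.Injective T := by
    rw [← LinearMap.ker_eq_bot, LinearMap.ker_eq_bot']
    intro q hq
    have := congrArg Subtype.val hq
    exact Subtype.ext (eq_zero_of_laplacian_normSqPoly_mul_eq_zero hn q.2 this)
  obtain ⟨q, hq⟩ := LinearMap.injective_iff_surjective.mp hT
    ⟨laplacian n p, isHomogeneous_laplacian hp⟩
  have hq' : laplacian n (normSqPoly n * q) = laplacian n p := congrArg Subtype.val hq
  refine ⟨p - normSqPoly n * q, q, hp.sub (hmul q.2), ?_, q.2, by ring⟩
  rw [map_sub, hq', sub_self]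

/-- On the unit sphere, a homogeneous polynomial of degree `m` is a sum of harmonic homogeneous
polynomials of degrees `m, m - 2, …`. -/
lemma exists_harmonic_sum (hn : n ≠ 0) (m : ℕ) :
    ∀ p : MvPolynomial (Fin n) ℝ, p.IsHomogeneous m →
      ∃ h : ℕ → MvPolynomial (Fin n) ℝ,
        (∀ j ∈ range (m / 2 + 1), (h j).IsHomogeneous (m - 2 * j) ∧ laplacian n (h j) = 0) ∧
        ∀ ω ∈ Metric.sphere (0 : EuclideanSpace ℝ (Fin n)) 1,
          eval (fun d => ω d) p = ∑ j ∈ range (m / 2 + 1), eval (fun d => ω d) (h j) := by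
  induction m using Nat.twoStepInduction with
  | zero =>
    intro p hp
    exact ⟨fun _ => p, by simpa using ⟨hp, laplacian_eq_zero_of_lt_two hp (by omega)⟩, by simp⟩
  | one =>
    intro p hp
    exact ⟨fun _ => p, by simpa using ⟨hp, laplacian_eq_zero_of_lt_two hp (by omega)⟩, by simp⟩
  | more m ih _ =>
    intro p hp
    obtain ⟨h, q, hh, hh0, hq, rfl⟩ := exists_harmonic_add_normSqPoly_mul hn hp
    obtain ⟨g, hg, hgs⟩ := ih q hq
    have hm : (m + 2) / 2 + 1 = (m / 2 + 1) + 1 := by omega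
    refine ⟨fun j => Nat.casesOn j h g, ?_, ?_⟩
    · intro j hj
      rcases j with _ | j
      · exact ⟨hh, hh0⟩
      · have := hg j (by simp at hj ⊢; omega)
        rwa [show m + 2 - 2 * (j + 1) = m - 2 * j by omega]
    · intro ω hω
      rw [hm, Finset.sum_range_succ', map_add, map_mul, eval_normSqPoly, hgs ω hω,
        mem_sphere_zero_iff_norm.mp hω]
      simp [add_comm]

lemma eval_smul_of_isHomogeneous {p : MvPolynomial (Fin n) ℝ} {m : ℕ} (hp : p.IsHomogeneous m)
    (c : ℝ) (x : EuclideanSpace ℝ (Fin n)) :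
    eval (fun d => (c • x) d) p = c ^ m * eval (fun d => x d) p := by
  rw [eval_eq', eval_eq', Finset.mul_sum]
  refine Finset.sum_congr rfl fun d hd => ?_
  simp only [PiLp.smul_apply, smul_eq_mul, mul_pow, Finset.prod_mul_distrib,
    Finset.prod_pow_eq_pow_sum]
  have hsum : ∑ i, d i = m := by
    rw [← Finsupp.degree_eq_sum]
    exact (hp.degree_eq_sum_deg_support hd).symm
  rw [hsum]
  ring

/-- Homogeneous polynomials whose degrees have the same parity and which agree on the sphere
differ by a power of `|x|²`. -/
lemma eq_normSqPoly_pow_mul_of_eqOn_sphere (hn : n ≠ 0) {p q : MvPolynomial (Fin n) ℝ} {j k : ℕ}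
    (hp : p.IsHomogeneous j) (hq : q.IsHomogeneous (j + 2 * k))
    (h : ∀ ω ∈ Metric.sphere (0 : EuclideanSpace ℝ (Fin n)) 1,
      eval (fun d => ω d) p = eval (fun d => ω d) q) :
    q = normSqPoly n ^ k * p := by
  apply mul_left_cancel₀ (normSqPoly_ne_zero hn)
  apply MvPolynomial.funext
  intro y
  obtain ⟨x, rfl⟩ : ∃ x : EuclideanSpace ℝ (Fin n), y = fun d => x d := ⟨WithLp.toLp 2 y, rfl⟩
  simp only [map_mul, map_pow, eval_normSqPoly]
  rcases eq_or_ne x 0 with rfl | hx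
  · simp
  · congr 1
    have hx' : ‖x‖ ≠ 0 := norm_ne_zero_iff.mpr hx
    have hu : ‖x‖⁻¹ • x ∈ Metric.sphere (0 : EuclideanSpace ℝ (Fin n)) 1 := by
      simp [norm_smul, hx']
    have hxu : x = ‖x‖ • (‖x‖⁻¹ • x) := by rw [smul_smul, mul_inv_cancel₀ hx', one_smul]
    have e1 := eval_smul_of_isHomogeneous hp ‖x‖ (‖x‖⁻¹ • x)
    have e2 := eval_smul_of_isHomogeneous hq ‖x‖ (‖x‖⁻¹ • x)
    rw [← hxu] at e1 e2
    rw [e1, e2, h _ hu]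
    ring

lemma eq_zero_of_harmonic_of_eqOn_sphere (hn : n ≠ 0) {p q : MvPolynomial (Fin n) ℝ} {j k : ℕ}
    (hp : p.IsHomogeneous j) (hq : q.IsHomogeneous (j + 2 * (k + 1))) (hq0 : laplacian n q = 0)
    (h : ∀ ω ∈ Metric.sphere (0 : EuclideanSpace ℝ (Fin n)) 1,
      eval (fun d => ω d) p = eval (fun d => ω d) q) :
    q = 0 := by
  have hqp := eq_normSqPoly_pow_mul_of_eqOn_sphere hn hp hq h
  rw [pow_succ', mul_assoc] at hqp
  rw [hqp] at hq0
  rw [hqp, eq_zero_of_laplacian_normSqPoly_mul_eq_zero hn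
    ((isHomogeneous_normSqPoly.pow k).mul hp) hq0, mul_zero]

lemma finrank_homogeneousSubmodule (hn : n ≠ 0) (m : ℕ) :
    Module.finrank ℝ (homogeneousSubmodule (Fin n) ℝ m) = (n + m - 1).choose (n - 1) := by
  rw [homogeneousSubmodule_eq_finsupp_supported]
  have hset : {d : Fin n →₀ ℕ | d.degree = m} =
      ((univ : Finset (Fin n)).finsuppAntidiag m : Set _) := by
    ext d
    simp [Finsupp.degree_eq_sum]
  rw [(AddMonoidAlgebra.supportedEquivFinsupp _).finrank_eq, hset]
  simp only [Finset.coe_sort_coe, Module.finrank_finsupp_self, Fintype.card_coe,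
    card_finsuppAntidiag_nat_eq_choose, card_univ, Fintype.card_fin]
  rw [← Nat.choose_symm (by omega)]
  congr 1
  omega

end Harmonic

section Measure

variable {n : ℕ} {σ : Measure (EuclideanSpace ℝ (Fin n))}

lemma continuous_eval_mvPolynomial (p : MvPolynomial (Fin n) ℝ) :
    Continuous fun ω : EuclideanSpace ℝ (Fin n) => MvPolynomial.eval (fun d => ω d) p :=
  (MvPolynomial.continuous_eval p).comp (PiLp.continuous_ofLp 2 _)

lemma integrable_of_continuous [IsProbabilityMeasure σ]
    (hsupp : σ (Metric.sphere (0 : EuclideanSpace ℝ (Fin n)) 1)ᶜ = 0)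
    {f : EuclideanSpace ℝ (Fin n) → ℝ} (hf : Continuous f) : Integrable f σ := by
  have h := hf.continuousOn.integrableOn_compact (μ := σ)
    (isCompact_sphere (0 : EuclideanSpace ℝ (Fin n)) 1)
  rwa [IntegrableOn, Measure.restrict_eq_self_of_ae_mem (s := Metric.sphere 0 1)
    (mem_ae_iff.mpr hsupp)] at h

lemma exists_isometry_map_eq {x y : EuclideanSpace ℝ (Fin n)} (h : ‖x‖ = ‖y‖) :
    ∃ g : EuclideanSpace ℝ (Fin n) ≃ₗᵢ[ℝ] EuclideanSpace ℝ (Fin n), g x = y ∧ g y = x := by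
  have hxy : (ℝ ∙ (x - y))ᗮ.reflection x = y := Submodule.reflection_sub h
  have hyx := congrArg (ℝ ∙ (x - y))ᗮ.reflection hxy
  rw [Submodule.reflection_reflection] at hyx
  exact ⟨(ℝ ∙ (x - y))ᗮ.reflection, hxy, hyx.symm⟩

lemma measure_ball_pos [IsProbabilityMeasure σ]
    (hsupp : σ (Metric.sphere (0 : EuclideanSpace ℝ (Fin n)) 1)ᶜ = 0)
    (hinv : ∀ g : EuclideanSpace ℝ (Fin n) ≃ₗᵢ[ℝ] EuclideanSpace ℝ (Fin n),
      MeasurePreserving g σ σ)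
    {x : EuclideanSpace ℝ (Fin n)} (hx : x ∈ Metric.sphere (0 : EuclideanSpace ℝ (Fin n)) 1)
    {r : ℝ} (hr : 0 < r) : 0 < σ (Metric.ball x r) := by
  by_contra! h0
  have h0 : σ (Metric.ball x r) = 0 := le_antisymm h0 zero_le
  have hball : ∀ y ∈ Metric.sphere (0 : EuclideanSpace ℝ (Fin n)) 1,
      σ (Metric.ball y r) = 0 := by
    intro y hy
    obtain ⟨g, hg, -⟩ := exists_isometry_map_eq
      ((mem_sphere_zero_iff_norm.mp hx).trans (mem_sphere_zero_iff_norm.mp hy).symm)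
    rw [← (hinv g).measure_preimage Metric.isOpen_ball.measurableSet.nullMeasurableSet, ← hg,
      g.isometry.preimage_ball]
    exact h0
  have hs : σ (Metric.sphere (0 : EuclideanSpace ℝ (Fin n)) 1) = 0 :=
    measure_null_of_locally_null _ fun y hy =>
      ⟨Metric.ball y r, mem_nhdsWithin_of_mem_nhds (Metric.ball_mem_nhds y hr), hball y hy⟩
  have h1 := measure_univ (μ := σ)
  rw [← Set.union_compl_self (Metric.sphere (0 : EuclideanSpace ℝ (Fin n)) 1),
    measure_union_null hs hsupp] at h1
  exact zero_ne_one h1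

lemma eq_zero_on_sphere_of_integral_eq_zero [IsProbabilityMeasure σ]
    (hsupp : σ (Metric.sphere (0 : EuclideanSpace ℝ (Fin n)) 1)ᶜ = 0)
    (hinv : ∀ g : EuclideanSpace ℝ (Fin n) ≃ₗᵢ[ℝ] EuclideanSpace ℝ (Fin n),
      MeasurePreserving g σ σ)
    {f : EuclideanSpace ℝ (Fin n) → ℝ} (hf : Continuous f)
    (hf0 : ∀ x ∈ Metric.sphere (0 : EuclideanSpace ℝ (Fin n)) 1, 0 ≤ f x)
    (hint : ∫ ω, f ω ∂σ = 0) :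
    ∀ x ∈ Metric.sphere (0 : EuclideanSpace ℝ (Fin n)) 1, f x = 0 := by
  intro x hx
  by_contra hne
  have hae : 0 ≤ᵐ[σ] f := by
    filter_upwards [mem_ae_iff.mpr hsupp] with ω hω using hf0 ω hω
  rw [integral_eq_zero_iff_of_nonneg_ae hae (integrable_of_continuous hsupp hf)] at hint
  obtain ⟨r, hr, hrs⟩ := Metric.isOpen_iff.mp (isOpen_ne_fun hf continuous_const) x hne
  exact (measure_ball_pos hsupp hinv hx hr).ne' (measure_mono_null hrs hint)

end Measure

section Zonal

variable {n : ℕ}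

lemma exists_orthogonal_unit (hn : 2 ≤ n) (x : EuclideanSpace ℝ (Fin n)) :
    ∃ v : EuclideanSpace ℝ (Fin n), ‖v‖ = 1 ∧ ⟪x, v⟫ = 0 := by
  have hlt : Module.finrank ℝ (ℝ ∙ x) < Module.finrank ℝ (EuclideanSpace ℝ (Fin n)) := by
    rw [finrank_euclideanSpace_fin]
    exact (finrank_span_le_card {x}).trans_lt (by simp; omega)
  have hne : (ℝ ∙ x)ᗮ ≠ ⊥ := by
    intro h
    rw [Submodule.orthogonal_eq_bot_iff] at h
    rw [h, finrank_top] at hlt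
    exact lt_irrefl _ hlt
  obtain ⟨w, hw, hw0⟩ := Submodule.exists_mem_ne_zero_of_ne_bot hne
  refine ⟨‖w‖⁻¹ • w, by simp [norm_smul, hw0], ?_⟩
  rw [inner_smul_right, Submodule.mem_orthogonal_singleton_iff_inner_right.mp hw, mul_zero]

lemma combination_mem_sphere {x v : EuclideanSpace ℝ (Fin n)} (hx : ‖x‖ = 1) (hv : ‖v‖ = 1)
    (hxv : ⟪x, v⟫ = 0) {t s : ℝ} (hts : t ^ 2 + s ^ 2 = 1) :
    t • x + s • v ∈ Metric.sphere (0 : EuclideanSpace ℝ (Fin n)) 1 := by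
  rw [mem_sphere_zero_iff_norm]
  have h : ‖t • x + s • v‖ ^ 2 = 1 := by
    rw [norm_add_sq_real, inner_smul_left, inner_smul_right, hxv, norm_smul, norm_smul, hx, hv]
    simp [hts]
  exact (pow_eq_one_iff_of_nonneg (norm_nonneg _) two_ne_zero).mp h

lemma inner_combination {x v : EuclideanSpace ℝ (Fin n)} (hx : ‖x‖ = 1)
    (hxv : ⟪x, v⟫ = 0) (t s : ℝ) : ⟪x, t • x + s • v⟫ = t := by
  rw [inner_add_right, inner_smul_right, inner_smul_right, hxv, real_inner_self_eq_norm_sq, hx]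
  simp

lemma exists_mem_sphere_inner_eq (hn : 2 ≤ n) {x : EuclideanSpace ℝ (Fin n)} (hx : ‖x‖ = 1)
    {t : ℝ} (ht : t ^ 2 ≤ 1) :
    ∃ ω ∈ Metric.sphere (0 : EuclideanSpace ℝ (Fin n)) 1, ⟪x, ω⟫ = t := by
  obtain ⟨v, hv, hxv⟩ := exists_orthogonal_unit hn x
  exact ⟨t • x + √(1 - t ^ 2) • v,
    combination_mem_sphere hx hv hxv (by rw [Real.sq_sqrt (by linarith)]; ring),
    inner_combination hx hxv _ _⟩

open Polynomial in
/-- A polynomial `q` such that `ω ↦ q ⟪x, ω⟫` is, on the sphere, homogeneous of degree `j`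
has degree at most `j`. -/
lemma natDegree_le_of_zonal (hn : 2 ≤ n) {x : EuclideanSpace ℝ (Fin n)} (hx : ‖x‖ = 1)
    {p : MvPolynomial (Fin n) ℝ} {j : ℕ} (hp : p.IsHomogeneous j) {q : ℝ[X]}
    (h : ∀ ω ∈ Metric.sphere (0 : EuclideanSpace ℝ (Fin n)) 1,
      MvPolynomial.eval (fun d => ω d) p = q.eval ⟪x, ω⟫) :
    q.natDegree ≤ j := by
  by_contra! hlt
  obtain ⟨v, hv, hxv⟩ := exists_orthogonal_unit hn x
  let P : ℝ[X] := MvPolynomial.aeval (fun d => C (x d) * (1 - X ^ 2) + C (v d) * (2 * X)) p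
  have hP (u : ℝ) : P.eval u = (1 + u ^ 2) ^ j * q.eval ((1 - u ^ 2) / (1 + u ^ 2)) := by
    have hu : (1 + u ^ 2 : ℝ) ≠ 0 := by positivity
    set ω := ((1 - u ^ 2) / (1 + u ^ 2)) • x + (2 * u / (1 + u ^ 2)) • v with hω
    have hωs : ω ∈ Metric.sphere (0 : EuclideanSpace ℝ (Fin n)) 1 :=
      combination_mem_sphere hx hv hxv (by field_simp; ring)
    have h1 := h ω hωs
    rw [inner_combination hx hxv] at h1
    rw [← h1, ← eval_smul_of_isHomogeneous hp]
    have h2 : P.eval u = MvPolynomial.eval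
        (fun d => (C (x d) * (1 - X ^ 2) + C (v d) * (2 * X) : ℝ[X]).eval u) p := by
      simp only [P, MvPolynomial.aeval_def, MvPolynomial.eval]
      rw [← Polynomial.coe_evalRingHom, MvPolynomial.hom_eval₂]
      congr 1
      ext r
      simp
    rw [h2]
    congr 2
    ext d
    simp [hω]
    field_simp
  have hpoly : (1 + X ^ 2) ^ (q.natDegree - j) * P =
      ∑ k ∈ range (q.natDegree + 1),
        C (q.coeff k) * (1 - X ^ 2) ^ k * (1 + X ^ 2) ^ (q.natDegree - k) := by
    refine Polynomial.funext fun u => ?_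
    have hu : (1 + u ^ 2 : ℝ) ≠ 0 := by positivity
    rw [eval_mul, hP, eval_pow, eval_finsetSum, eval_eq_sum_range (p := q), ← mul_assoc]
    simp only [eval_add, eval_one, eval_pow, eval_X, eval_mul, eval_C, eval_sub]
    rw [← pow_add, Nat.sub_add_cancel hlt.le, Finset.mul_sum]
    refine Finset.sum_congr rfl fun k hk => ?_
    have hk' : k ≤ q.natDegree := by simp at hk; omega
    rw [← pow_sub_mul_pow _ hk', div_pow]
    field_simp
  have hI := congrArg (aeval Complex.I) hpoly
  rw [Finset.sum_range_succ] at hI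
  simp only [map_mul, map_pow, map_add, map_sub, map_one, aeval_X, aeval_C, map_sum,
    Complex.I_sq] at hI
  rw [add_neg_cancel, zero_pow (by omega), zero_mul, Finset.sum_eq_zero, Nat.sub_self] at hI
  · have hq : q ≠ 0 := by
      rintro rfl
      simp at hlt
    norm_num at hI
    exact hq hI
  · intro k hk
    rw [zero_pow (by simp at hk; omega), mul_zero]

end Zonal

section Kernel

open MvPolynomial

variable {n : ℕ} {σ : Measure (EuclideanSpace ℝ (Fin n))}

/-- `e` is a family of harmonic homogeneous polynomials of degree `j`, orthonormal in `L²(σ)`,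
which spans all such polynomials on the sphere and has reproducing kernel `q ⟪ω, ω'⟫`. -/
structure IsZonalBasis (σ : Measure (EuclideanSpace ℝ (Fin n))) (j : ℕ) (q : Polynomial ℝ)
    {m : ℕ} (e : Fin m → MvPolynomial (Fin n) ℝ) : Prop where
  isHomogeneous : ∀ i, (e i).IsHomogeneous j
  laplacian_eq_zero : ∀ i, laplacian n (e i) = 0
  orthonormal : ∀ i i' : Fin m,
    ∫ ω, eval (fun d => ω d) (e i) * eval (fun d => ω d) (e i') ∂σ = if i = i' then 1 else 0
  exists_eq_sum : ∀ p : MvPolynomial (Fin n) ℝ, p.IsHomogeneous j → laplacian n p = 0 →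
    ∃ a : Fin m → ℝ, ∀ ω ∈ Metric.sphere (0 : EuclideanSpace ℝ (Fin n)) 1,
      eval (fun d => ω d) p = ∑ i, a i * eval (fun d => ω d) (e i)
  kernel : ∀ ω ∈ Metric.sphere (0 : EuclideanSpace ℝ (Fin n)) 1,
    ∀ ω' ∈ Metric.sphere (0 : EuclideanSpace ℝ (Fin n)) 1,
      ∑ i, eval (fun d => ω d) (e i) * eval (fun d => ω' d) (e i) = Polynomial.eval ⟪ω, ω'⟫ q

lemma integral_congr_on_sphere (hsupp : σ (Metric.sphere (0 : EuclideanSpace ℝ (Fin n)) 1)ᶜ = 0)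
    {f g : EuclideanSpace ℝ (Fin n) → ℝ}
    (h : ∀ ω ∈ Metric.sphere (0 : EuclideanSpace ℝ (Fin n)) 1, f ω = g ω) :
    ∫ ω, f ω ∂σ = ∫ ω, g ω ∂σ :=
  integral_congr_ae (by filter_upwards [mem_ae_iff.mpr hsupp] with ω hω using h ω hω)

lemma integral_sum_mul_sum [IsProbabilityMeasure σ]
    (hsupp : σ (Metric.sphere (0 : EuclideanSpace ℝ (Fin n)) 1)ᶜ = 0) {ι κ : Type*}
    (s : Finset ι) (t : Finset κ) {f : ι → EuclideanSpace ℝ (Fin n) → ℝ}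
    {g : κ → EuclideanSpace ℝ (Fin n) → ℝ}
    (hf : ∀ i, Continuous (f i)) (hg : ∀ i, Continuous (g i)) :
    ∫ ω, (∑ i ∈ s, f i ω) * ∑ k ∈ t, g k ω ∂σ = ∑ i ∈ s, ∑ k ∈ t, ∫ ω, f i ω * g k ω ∂σ := by
  simp_rw [Finset.sum_mul_sum]
  rw [integral_finsetSum]
  · refine Finset.sum_congr rfl fun i _ => ?_
    rw [integral_finsetSum]
    exact fun k _ => integrable_of_continuous hsupp ((hf i).mul (hg k))
  · exact fun i _ => integrable_of_continuous hsupp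
      (continuous_finsetSum _ fun k _ => (hf i).mul (hg k))

lemma integral_linearCombination_mul [IsProbabilityMeasure σ]
    (hsupp : σ (Metric.sphere (0 : EuclideanSpace ℝ (Fin n)) 1)ᶜ = 0) {m m' : ℕ}
    (e : Fin m → MvPolynomial (Fin n) ℝ) (f : Fin m' → MvPolynomial (Fin n) ℝ)
    (a : Fin m → ℝ) (b : Fin m' → ℝ) :
    ∫ ω, (∑ i, a i * eval (fun d => ω d) (e i)) * ∑ k, b k * eval (fun d => ω d) (f k) ∂σ =
      ∑ i, ∑ k, a i * b k * ∫ ω, eval (fun d => ω d) (e i) * eval (fun d => ω d) (f k) ∂σ := by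
  rw [integral_sum_mul_sum hsupp _ _
    (fun i => (continuous_eval_mvPolynomial (e i)).const_mul (a i))
    (fun k => (continuous_eval_mvPolynomial (f k)).const_mul (b k))]
  simp_rw [mul_mul_mul_comm, integral_const_mul]

namespace IsZonalBasis

variable {j : ℕ} {q : Polynomial ℝ} {m : ℕ} {e : Fin m → MvPolynomial (Fin n) ℝ}

lemma integral_linearCombination_mul_self [IsProbabilityMeasure σ]
    (hsupp : σ (Metric.sphere (0 : EuclideanSpace ℝ (Fin n)) 1)ᶜ = 0)
    (he : IsZonalBasis σ j q e) (a b : Fin m → ℝ) :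
    ∫ ω, (∑ i, a i * eval (fun d => ω d) (e i)) * ∑ k, b k * eval (fun d => ω d) (e k) ∂σ =
      ∑ i, a i * b i := by
  rw [integral_linearCombination_mul hsupp]
  simp [he.orthonormal]

lemma eq_zero_of_linearCombination_eq_zero [IsProbabilityMeasure σ]
    (hsupp : σ (Metric.sphere (0 : EuclideanSpace ℝ (Fin n)) 1)ᶜ = 0)
    (he : IsZonalBasis σ j q e) {a : Fin m → ℝ}
    (h : ∀ ω ∈ Metric.sphere (0 : EuclideanSpace ℝ (Fin n)) 1,
      ∑ i, a i * eval (fun d => ω d) (e i) = 0) (i : Fin m) : a i = 0 := by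
  have h1 := he.integral_linearCombination_mul_self hsupp a a
  rw [integral_congr_on_sphere (g := fun _ => 0) hsupp fun ω hω => by rw [h ω hω, zero_mul],
    integral_zero, eq_comm, Finset.sum_eq_zero_iff_of_nonneg fun i _ => mul_self_nonneg _] at h1
  exact mul_self_eq_zero.mp (h1 i (mem_univ i))

lemma natDegree_le (hn : 2 ≤ n) (he : IsZonalBasis σ j q e) : q.natDegree ≤ j := by
  have hx : ‖EuclideanSpace.single (⟨0, by omega⟩ : Fin n) (1 : ℝ)‖ = 1 := by simp
  set x := EuclideanSpace.single (⟨0, by omega⟩ : Fin n) (1 : ℝ)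
  refine natDegree_le_of_zonal hn hx
    (p := ∑ i, C (eval (fun d => x d) (e i)) * e i)
    (IsHomogeneous.sum _ _ _ fun i _ => (he.isHomogeneous i).C_mul _) fun ω hω => ?_
  rw [← he.kernel x (mem_sphere_zero_iff_norm.mpr hx) ω hω]
  simp

/-- Harmonic polynomials of different degrees of the same parity are orthogonal. -/
lemma integral_mul_eq_zero [IsProbabilityMeasure σ] (hn : n ≠ 0)
    (hsupp : σ (Metric.sphere (0 : EuclideanSpace ℝ (Fin n)) 1)ᶜ = 0)
    (hinv : ∀ g : EuclideanSpace ℝ (Fin n) ≃ₗᵢ[ℝ] EuclideanSpace ℝ (Fin n),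
      MeasurePreserving g σ σ)
    {k : ℕ} {q' : Polynomial ℝ} {m' : ℕ} {f : Fin m' → MvPolynomial (Fin n) ℝ}
    (he : IsZonalBasis σ j q e) (hf : IsZonalBasis σ (j + 2 * (k + 1)) q' f)
    (i : Fin m) (i' : Fin m') :
    ∫ ω, eval (fun d => ω d) (e i) * eval (fun d => ω d) (f i') ∂σ = 0 := by
  set A : Fin m → Fin m' → ℝ := fun i i' =>
    ∫ ω, eval (fun d => ω d) (e i) * eval (fun d => ω d) (f i') ∂σ with hA
  have hK : ∀ x ∈ Metric.sphere (0 : EuclideanSpace ℝ (Fin n)) 1,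
      ∀ y ∈ Metric.sphere (0 : EuclideanSpace ℝ (Fin n)) 1,
      ∑ i, ∑ i', eval (fun d => x d) (e i) * eval (fun d => y d) (f i') * A i i' =
        ∫ ω, q.eval ⟪x, ω⟫ * q'.eval ⟪y, ω⟫ ∂σ := by
    intro x hx y hy
    rw [hA, ← integral_linearCombination_mul hsupp]
    exact integral_congr_on_sphere hsupp fun ω hω => by
      rw [he.kernel x hx ω hω, hf.kernel y hy ω hω]
  have hsymm : ∀ x ∈ Metric.sphere (0 : EuclideanSpace ℝ (Fin n)) 1,
      ∀ y ∈ Metric.sphere (0 : EuclideanSpace ℝ (Fin n)) 1,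
      ∫ ω, q.eval ⟪x, ω⟫ * q'.eval ⟪y, ω⟫ ∂σ = ∫ ω, q.eval ⟪y, ω⟫ * q'.eval ⟪x, ω⟫ ∂σ := by
    intro x hx y hy
    obtain ⟨g, hgx, hgy⟩ := exists_isometry_map_eq
      ((mem_sphere_zero_iff_norm.mp hx).trans (mem_sphere_zero_iff_norm.mp hy).symm)
    rw [← (hinv g).integral_comp g.toHomeomorph.measurableEmbedding
      fun ω => q.eval ⟪x, ω⟫ * q'.eval ⟪y, ω⟫]
    refine integral_congr_ae (.of_forall fun ω => ?_)
    have h1 : ⟪x, g ω⟫ = ⟪y, ω⟫ := by rw [← hgy, g.inner_map_map]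
    have h2 : ⟪y, g ω⟫ = ⟪x, ω⟫ := by rw [← hgx, g.inner_map_map]
    simp only [h1, h2]
  have hzero : ∀ y ∈ Metric.sphere (0 : EuclideanSpace ℝ (Fin n)) 1, ∀ i',
      ∑ i, A i i' * eval (fun d => y d) (e i) = 0 := by
    intro y hy
    have hpoly : (∑ i', C (∑ i, A i i' * eval (fun d => y d) (e i)) * f i') = 0 := by
      refine eq_zero_of_harmonic_of_eqOn_sphere hn
        (p := ∑ i, C (∑ i', A i i' * eval (fun d => y d) (f i')) * e i) (j := j) (k := k)
        (IsHomogeneous.sum _ _ _ fun i _ => (he.isHomogeneous i).C_mul _)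
        (IsHomogeneous.sum _ _ _ fun i _ => (hf.isHomogeneous i).C_mul _) ?_ ?_
      · rw [map_sum]
        refine Finset.sum_eq_zero fun i' _ => ?_
        rw [← smul_eq_C_mul, map_smul, hf.laplacian_eq_zero, smul_zero]
      · intro x hx
        have h1 := (hK x hx y hy).trans ((hsymm x hx y hy).trans (hK y hy x hx).symm)
        simp only [map_sum, map_mul, eval_C, Finset.sum_mul]
        rw [Finset.sum_comm (s := (univ : Finset (Fin m')))]
        refine Eq.trans ?_ (h1.trans ?_) <;>
          exact Finset.sum_congr rfl fun _ _ => Finset.sum_congr rfl fun _ _ => by ring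
    refine hf.eq_zero_of_linearCombination_eq_zero hsupp fun ω _ => ?_
    simpa using congrArg (eval fun d => ω d) hpoly
  exact he.eq_zero_of_linearCombination_eq_zero hsupp (a := fun i => A i i')
    (fun ω hω => hzero ω hω i') i

end IsZonalBasis

/-- The kernel `∑ⱼ Q^{(l-2j)}` reproduces homogeneous polynomials of degree `l`. -/
lemma exists_reproducing_polynomial [IsProbabilityMeasure σ] (hn : n ≠ 0)
    (hsupp : σ (Metric.sphere (0 : EuclideanSpace ℝ (Fin n)) 1)ᶜ = 0)
    (hinv : ∀ g : EuclideanSpace ℝ (Fin n) ≃ₗᵢ[ℝ] EuclideanSpace ℝ (Fin n),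
      MeasurePreserving g σ σ)
    {Q : ℕ → Polynomial ℝ} {m : ℕ → ℕ} {e : ∀ j, Fin (m j) → MvPolynomial (Fin n) ℝ}
    (he : ∀ j, IsZonalBasis σ j (Q j) (e j)) (l : ℕ) {y : EuclideanSpace ℝ (Fin n)}
    (hy : y ∈ Metric.sphere (0 : EuclideanSpace ℝ (Fin n)) 1) :
    ∃ Z : MvPolynomial (Fin n) ℝ, Z.totalDegree ≤ l ∧
      (∀ ω : EuclideanSpace ℝ (Fin n),
        eval (fun d => (-ω) d) Z = (-1) ^ l * eval (fun d => ω d) Z) ∧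
      (∀ ω ∈ Metric.sphere (0 : EuclideanSpace ℝ (Fin n)) 1,
        eval (fun d => ω d) Z = (∑ j ∈ range (l / 2 + 1), Q (l - 2 * j)).eval ⟪ω, y⟫) ∧
      ∀ p : MvPolynomial (Fin n) ℝ, p.IsHomogeneous l →
        ∫ ω, eval (fun d => ω d) p * eval (fun d => ω d) Z ∂σ = eval (fun d => y d) p := by
  set z : ℕ → MvPolynomial (Fin n) ℝ := fun j => ∑ i, C (eval (fun d => y d) (e j i)) * e j i
  have hz (j : ℕ) (ω : EuclideanSpace ℝ (Fin n)) : eval (fun d => ω d) (z j) =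
      ∑ i, eval (fun d => y d) (e j i) * eval (fun d => ω d) (e j i) := by
    simp [z]
  have hzhom (j : ℕ) : (z j).IsHomogeneous j :=
    IsHomogeneous.sum _ _ _ fun i _ => ((he j).isHomogeneous i).C_mul _
  refine ⟨∑ j ∈ range (l / 2 + 1), z (l - 2 * j), ?_, ?_, ?_, ?_⟩
  · exact totalDegree_finsetSum_le fun j _ => (hzhom _).totalDegree_le.trans (Nat.sub_le _ _)
  · intro ω
    rw [map_sum, map_sum, Finset.mul_sum]
    refine Finset.sum_congr rfl fun j hj => ?_
    have hjl : l = l - 2 * j + 2 * j := by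
      simp only [Finset.mem_range] at hj
      omega
    rw [← neg_one_smul ℝ ω, eval_smul_of_isHomogeneous (hzhom _)]
    conv_rhs => rw [hjl, pow_add, pow_mul, neg_one_sq, one_pow, mul_one, ← hjl]
  · intro ω hω
    rw [map_sum, Polynomial.eval_finsetSum]
    refine Finset.sum_congr rfl fun j _ => ?_
    rw [hz, (he _).kernel y hy ω hω, real_inner_comm]
  · intro p hp
    obtain ⟨h, hh, hps⟩ := exists_harmonic_sum hn l p hp
    rw [hps y hy, integral_congr_on_sphere (g := fun ω =>
      (∑ j ∈ range (l / 2 + 1), eval (fun d => ω d) (h j)) *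
        ∑ j ∈ range (l / 2 + 1), eval (fun d => ω d) (z (l - 2 * j))) hsupp
      fun ω hω => by rw [hps ω hω, map_sum], integral_sum_mul_sum hsupp _ _
      (fun _ => continuous_eval_mvPolynomial _) (fun _ => continuous_eval_mvPolynomial _)]
    refine Finset.sum_congr rfl fun j hj => ?_
    obtain ⟨a, ha⟩ := (he _).exists_eq_sum _ (hh j hj).1 (hh j hj).2
    have hint (k : ℕ) : ∫ ω, eval (fun d => ω d) (h j) * eval (fun d => ω d) (z k) ∂σ =
        ∫ ω, (∑ i, a i * eval (fun d => ω d) (e (l - 2 * j) i)) *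
          ∑ i, eval (fun d => y d) (e k i) * eval (fun d => ω d) (e k i) ∂σ :=
      integral_congr_on_sphere hsupp fun ω hω => by rw [ha ω hω, hz]
    rw [Finset.sum_eq_single j, hint, (he _).integral_linearCombination_mul_self hsupp, ha y hy]
    · intro k hk hkj
      rw [hint, integral_linearCombination_mul hsupp]
      refine Finset.sum_eq_zero fun i _ => Finset.sum_eq_zero fun i' _ => ?_
      refine mul_eq_zero_of_right _ ?_
      simp only [Finset.mem_range] at hj hk
      have cross (a b c : ℕ) (hab : a = b + 2 * (c + 1)) (i : Fin (m b)) (i' : Fin (m a)) :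
          ∫ ω, eval (fun d => ω d) (e b i) * eval (fun d => ω d) (e a i') ∂σ = 0 := by
        subst hab
        exact (he b).integral_mul_eq_zero hn hsupp hinv (he _) i i'
      rcases lt_or_gt_of_ne hkj with hlt | hlt
      · exact cross _ _ (j - k - 1) (by omega) i i'
      · simp_rw [mul_comm (eval _ (e (l - 2 * j) i))]
        exact cross _ _ (k - j - 1) (by omega) i' i
    · exact fun hj' => absurd hj hj'

end Kernel

section Antipodal

variable {n : ℕ}

lemma exists_half_of_antipodal {X : Finset (EuclideanSpace ℝ (Fin n))} (h0 : 0 ∉ X)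
    (hanti : ∀ x ∈ X, -x ∈ X) :
    ∃ Y ⊆ X, (∀ x ∈ X, x ∈ Y ∨ -x ∈ Y) ∧ X.card = 2 * Y.card := by
  classical
  have hne {x : EuclideanSpace ℝ (Fin n)} (hx : x ∈ X) : toLex x.ofLp ≠ 0 := by
    intro h
    have hx0 : x.ofLp = 0 := h
    exact h0 (by rwa [(WithLp.ofLp_eq_zero 2).mp hx0] at hx)
  have hneg (x : EuclideanSpace ℝ (Fin n)) : toLex (-x).ofLp = -toLex x.ofLp := rfl
  have himage : (X.filter fun x => ¬ 0 < toLex x.ofLp) =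
      (X.filter fun x => 0 < toLex x.ofLp).image Neg.neg := by
    ext x
    simp only [Finset.mem_filter, Finset.mem_image]
    constructor
    · rintro ⟨hx, hx0⟩
      refine ⟨-x, ⟨hanti x hx, ?_⟩, neg_neg x⟩
      rw [hneg]
      exact Left.neg_pos_iff.mpr (lt_of_le_of_ne (not_lt.mp hx0) (hne hx))
    · rintro ⟨y, ⟨hy, hy0⟩, rfl⟩
      refine ⟨hanti y hy, ?_⟩
      rw [hneg]
      exact (Left.neg_neg_iff.mpr hy0).not_gt
  refine ⟨X.filter fun x => 0 < toLex x.ofLp, Finset.filter_subset _ _, fun x hx => ?_, ?_⟩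
  · simp only [Finset.mem_filter, hx, hanti x hx, true_and, hneg]
    exact (lt_or_gt_of_ne (hne hx)).elim (fun h => .inr (Left.neg_pos_iff.mpr h)) .inl
  · rw [← Finset.card_filter_add_card_filter_not (s := X) fun x => 0 < toLex x.ofLp, himage,
      Finset.card_image_of_injective _ neg_injective, two_mul]

open MvPolynomial in
lemma eval_neg_eq_zero_of_isHomogeneous {p : MvPolynomial (Fin n) ℝ} {l : ℕ}
    (hp : p.IsHomogeneous l) {x : EuclideanSpace ℝ (Fin n)} (h : eval (fun d => x d) p = 0) :
    eval (fun d => (-x) d) p = 0 := by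
  rw [← neg_one_smul ℝ x, eval_smul_of_isHomogeneous hp, h, mul_zero]

open MvPolynomial in
/-- If homogeneous polynomials of degree `l` are determined by their values on an antipodal set
of twice the dimension, they interpolate arbitrary values on each half of it. -/
lemma exists_interpolating_polynomial (hn : n ≠ 0) {l : ℕ}
    {X : Finset (EuclideanSpace ℝ (Fin n))} (h0 : 0 ∉ X) (hanti : ∀ x ∈ X, -x ∈ X)
    (hcard : X.card = 2 * (n + l - 1).choose (n - 1))
    (hinj : ∀ p : MvPolynomial (Fin n) ℝ, p.IsHomogeneous l →
      (∀ x ∈ X, eval (fun d => x d) p = 0) → p = 0)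
    {x : EuclideanSpace ℝ (Fin n)} (hx : x ∈ X) :
    ∃ p : MvPolynomial (Fin n) ℝ, p.IsHomogeneous l ∧ eval (fun d => x d) p ≠ 0 ∧
      ∀ z ∈ X, z ≠ x → z ≠ -x → eval (fun d => z d) p = 0 := by
  classical
  obtain ⟨Y, hYX, hY, hYcard⟩ := exists_half_of_antipodal h0 hanti
  have : FiniteDimensional ℝ (homogeneousSubmodule (Fin n) ℝ l) :=
    Module.Finite.iff_fg.mpr (homogeneousSubmodule_fg _ _ l)
  let T : homogeneousSubmodule (Fin n) ℝ l →ₗ[ℝ] (Y → ℝ) :=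
    LinearMap.pi (fun y => (aeval fun d => y.1 d).toLinearMap) ∘ₗ Submodule.subtype _
  have hTapp (p : homogeneousSubmodule (Fin n) ℝ l) (y : Y) :
      T p y = eval (fun d => y.1 d) p.1 := by
    simp [T, aeval_eq_eval]
  have hT : Function.Injective T := by
    rw [← LinearMap.ker_eq_bot, LinearMap.ker_eq_bot']
    intro p hp
    refine Subtype.ext (hinj p p.2 fun z hz => ?_)
    have hpY (y) (hy : y ∈ Y) : eval (fun d => y d) p.1 = 0 := by
      rw [← hTapp p ⟨y, hy⟩, hp, Pi.zero_apply]
    rcases hY z hz with hzY | hzY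
    · exact hpY z hzY
    · have := eval_neg_eq_zero_of_isHomogeneous p.2 (hpY _ hzY)
      rwa [neg_neg] at this
  have hTsurj : Function.Surjective T := by
    rw [← LinearMap.injective_iff_surjective_of_finrank_eq_finrank]
    · exact hT
    · rw [finrank_homogeneousSubmodule hn, Module.finrank_fintype_fun_eq_card, Fintype.card_coe]
      omega
  have hint {x : EuclideanSpace ℝ (Fin n)} (hx : x ∈ Y) :
      ∃ p : MvPolynomial (Fin n) ℝ, p.IsHomogeneous l ∧ eval (fun d => x d) p ≠ 0 ∧
        ∀ z ∈ X, z ≠ x → z ≠ -x → eval (fun d => z d) p = 0 := by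
    obtain ⟨p, hp⟩ := hTsurj (Pi.single ⟨x, hx⟩ 1)
    refine ⟨p, p.2, ?_, fun z hz hzx hzx' => ?_⟩
    · rw [← hTapp p ⟨x, hx⟩, hp]
      simp
    · rcases hY z hz with hzY | hzY
      · rw [← hTapp p ⟨z, hzY⟩, hp, Pi.single_eq_of_ne (by simpa using hzx)]
      · have h1 : eval (fun d => (-z) d) p.1 = 0 := by
          rw [← hTapp p ⟨-z, hzY⟩, hp, Pi.single_eq_of_ne]
          simpa [neg_eq_iff_eq_neg] using hzx'
        have := eval_neg_eq_zero_of_isHomogeneous p.2 h1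
        rwa [neg_neg] at this
  rcases hY x hx with hxY | hxY
  · exact hint hxY
  · obtain ⟨p, hp, hpx, hpz⟩ := hint hxY
    refine ⟨p, hp, fun h => hpx (eval_neg_eq_zero_of_isHomogeneous hp h), fun z hz h1 h2 => ?_⟩
    exact hpz z hz h2 (by rwa [neg_neg])

lemma inner_mem_Ioo {x y : EuclideanSpace ℝ (Fin n)} (hx : ‖x‖ = 1) (hy : ‖y‖ = 1)
    (h1 : x ≠ y) (h2 : x ≠ -y) : ⟪x, y⟫ ∈ Set.Ioo (-1 : ℝ) 1 := by
  refine ⟨?_, (inner_lt_one_iff_real_of_norm_eq_one hx hy).mpr h1⟩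
  have h := (inner_lt_one_iff_real_of_norm_eq_one hx ((norm_neg y).trans hy)).mpr h2
  rw [inner_neg_right] at h
  linarith

open MvPolynomial in
/-- The linear form `⟪x, ·⟫` as a polynomial. -/
lemma exists_linear_polynomial (x : EuclideanSpace ℝ (Fin n)) :
    ∃ L : MvPolynomial (Fin n) ℝ, L.totalDegree ≤ 1 ∧
      ∀ ω : EuclideanSpace ℝ (Fin n), eval (fun d => ω d) L = ⟪x, ω⟫ :=
  ⟨∑ d, C (x d) * X d,
    (IsHomogeneous.sum _ _ _ fun d _ => isHomogeneous_C_mul_X (x d) d).totalDegree_le,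
    fun ω => by simp [PiLp.inner_apply, mul_comm]⟩

end Antipodal

section Cubature

open MvPolynomial

variable {n l : ℕ} {σ : Measure (EuclideanSpace ℝ (Fin n))} [IsProbabilityMeasure σ]
  {X : Finset (EuclideanSpace ℝ (Fin n))} {W : EuclideanSpace ℝ (Fin n) → ℝ}

/-- A homogeneous polynomial of degree `l` vanishing on the nodes of a cubature formula of
strength `2l+1` is zero. -/
lemma eq_zero_of_eval_eq_zero_on_nodes (hn : n ≠ 0)
    (hsupp : σ (Metric.sphere (0 : EuclideanSpace ℝ (Fin n)) 1)ᶜ = 0)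
    (hinv : ∀ g : EuclideanSpace ℝ (Fin n) ≃ₗᵢ[ℝ] EuclideanSpace ℝ (Fin n),
      MeasurePreserving g σ σ)
    (hcub : ∀ p : MvPolynomial (Fin n) ℝ, p.totalDegree ≤ 2 * l + 1 →
      ∑ x ∈ X, W x * eval (fun i => x i) p = ∫ ω, eval (fun i => ω i) p ∂σ)
    {p : MvPolynomial (Fin n) ℝ} (hp : p.IsHomogeneous l)
    (hpX : ∀ x ∈ X, eval (fun d => x d) p = 0) : p = 0 := by
  have hpp := hcub (p * p) ((totalDegree_mul _ _).trans (by have := hp.totalDegree_le; omega))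
  rw [Finset.sum_eq_zero fun x hx => by rw [map_mul, hpX x hx]; ring] at hpp
  have hz := eq_zero_on_sphere_of_integral_eq_zero hsupp hinv (continuous_eval_mvPolynomial (p * p))
    (fun x _ => by rw [map_mul]; exact mul_self_nonneg _) hpp.symm
  have := eq_normSqPoly_pow_mul_of_eqOn_sphere hn (isHomogeneous_zero (Fin n) ℝ l)
    (k := 0) (q := p) hp fun ω hω => by
      have := hz ω hω
      rw [map_mul, mul_self_eq_zero] at this
      rw [this, map_zero]
  simpa using this

/-- The number of inner products different from `±1` of a node with the other nodes of a cubature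
formula of strength `2l+1` is at least `l`. -/
lemma le_card_inner_products (hn : 2 ≤ n)
    (hsupp : σ (Metric.sphere (0 : EuclideanSpace ℝ (Fin n)) 1)ᶜ = 0)
    (hinv : ∀ g : EuclideanSpace ℝ (Fin n) ≃ₗᵢ[ℝ] EuclideanSpace ℝ (Fin n),
      MeasurePreserving g σ σ)
    (hcub : ∀ p : MvPolynomial (Fin n) ℝ, p.totalDegree ≤ 2 * l + 1 →
      ∑ x ∈ X, W x * eval (fun i => x i) p = ∫ ω, eval (fun i => ω i) p ∂σ)
    {x : EuclideanSpace ℝ (Fin n)} (hx : ‖x‖ = 1) {B : Finset ℝ}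
    (hB : ∀ y ∈ X, y ≠ x → y ≠ -x → ⟪x, y⟫ ∈ B) : l ≤ B.card := by
  by_contra! hlt
  obtain ⟨L, hL, hLe⟩ := exists_linear_polynomial x
  set R : MvPolynomial (Fin n) ℝ := ∏ b ∈ B, (L - C b) with hR
  have hRdeg : R.totalDegree ≤ B.card := by
    refine (totalDegree_finsetProd _ _).trans ?_
    rw [← mul_one B.card, ← smul_eq_mul, ← Finset.sum_const]
    refine Finset.sum_le_sum fun b _ => ?_
    exact (totalDegree_sub_C_le _ _).trans hL
  have hRe (ω : EuclideanSpace ℝ (Fin n)) :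
      eval (fun d => ω d) R = ∏ b ∈ B, (⟪x, ω⟫ - b) := by
    simp [hR, map_prod, hLe]
  have hGdeg : (R ^ 2 * (1 - L ^ 2)).totalDegree ≤ 2 * l + 1 := by
    have h1 := totalDegree_mul (R ^ 2) (1 - L ^ 2)
    have h2 := totalDegree_pow R 2
    have h3 := totalDegree_sub (1 : MvPolynomial (Fin n) ℝ) (L ^ 2)
    have h4 := totalDegree_pow L 2
    rw [totalDegree_one] at h3
    omega
  have hGe (ω : EuclideanSpace ℝ (Fin n)) : eval (fun d => ω d) (R ^ 2 * (1 - L ^ 2)) =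
      (∏ b ∈ B, (⟪x, ω⟫ - b)) ^ 2 * (1 - ⟪x, ω⟫ ^ 2) := by
    rw [map_mul, map_pow, hRe, map_sub, map_pow, hLe, map_one]
  have hsum := hcub _ hGdeg
  rw [Finset.sum_eq_zero] at hsum
  · have hz := eq_zero_on_sphere_of_integral_eq_zero hsupp hinv
      (continuous_eval_mvPolynomial (R ^ 2 * (1 - L ^ 2))) (fun ω hω => by
        rw [hGe]
        refine mul_nonneg (sq_nonneg _) (sub_nonneg.mpr ((sq_le_one_iff_abs_le_one _).mpr ?_))
        have := abs_real_inner_le_norm x ω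
        rwa [hx, mem_sphere_zero_iff_norm.mp hω, one_mul] at this) hsum.symm
    obtain ⟨t, ht, htB⟩ := ((Set.Ioo_infinite (show (-1 : ℝ) < 1 by norm_num)).sdiff
      B.finite_toSet).nonempty
    have ht2 : t ^ 2 < 1 := (sq_lt_one_iff_abs_lt_one t).mpr (abs_lt.mpr ht)
    obtain ⟨ω, hω, hxω⟩ := exists_mem_sphere_inner_eq hn hx ht2.le
    have h := hz ω hω
    rw [hGe, hxω] at h
    refine mul_ne_zero (pow_ne_zero 2 (Finset.prod_ne_zero_iff.mpr fun b hb h0 => htB ?_))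
      (by linarith) h
    rwa [sub_eq_zero.mp h0]
  · intro y hy
    rw [hGe]
    rcases eq_or_ne y x with rfl | h1
    · simp [hx]
    rcases eq_or_ne y (-x) with rfl | h2
    · simp [hx]
    rw [Finset.prod_eq_zero (hB y hy h1 h2) (sub_self _)]
    ring

end Cubature

end SphericalCubature

/-- a tight antipodal cubature formula `(X,W)` of strength `2l+1` on
`𝕊^{n-1}` (i.e. `|X| = 2·C(n+l−1,n−1)`) has uniform weight `1/|X|`, and the set `B_X` of
inner products `⟪x,y⟫` with `x ≠ ±y` coincides with the set of real roots of
`C^{(l)} = ∑_{0≤j≤⌊l/2⌋} Q^{(l−2j)}`, where `Q^{(j)}` gives the reproducing kernel of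
`H^{(j)}(𝕊^{n-1})`. -/
theorem tight_odd_cubature_uniform_and_inner_products_eq_roots
    (n l : ℕ) (hn : 2 ≤ n)
    (σ : Measure (EuclideanSpace ℝ (Fin n))) [IsProbabilityMeasure σ]
    (hsupp : σ (Metric.sphere (0 : EuclideanSpace ℝ (Fin n)) 1)ᶜ = 0)
    (hinv : ∀ g : EuclideanSpace ℝ (Fin n) ≃ₗᵢ[ℝ] EuclideanSpace ℝ (Fin n),
      MeasurePreserving g σ σ)
    (Q : ℕ → Polynomial ℝ)
    (hQ : ∀ j : ℕ, ∃ (m : ℕ) (e : Fin m → MvPolynomial (Fin n) ℝ),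
      (∀ i, (e i).IsHomogeneous j) ∧
      (∀ i, (∑ d : Fin n, MvPolynomial.pderiv d (MvPolynomial.pderiv d (e i))) = 0) ∧
      (∀ i i' : Fin m,
        ∫ ω, MvPolynomial.eval (fun d => ω d) (e i)
            * MvPolynomial.eval (fun d => ω d) (e i') ∂σ
          = if i = i' then 1 else 0) ∧
      (∀ p : MvPolynomial (Fin n) ℝ, p.IsHomogeneous j →
        (∑ d : Fin n, MvPolynomial.pderiv d (MvPolynomial.pderiv d p)) = 0 →
        ∃ a : Fin m → ℝ, ∀ ω ∈ Metric.sphere (0 : EuclideanSpace ℝ (Fin n)) 1,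
          MvPolynomial.eval (fun d => ω d) p
            = ∑ i, a i * MvPolynomial.eval (fun d => ω d) (e i)) ∧
      (∀ ω ∈ Metric.sphere (0 : EuclideanSpace ℝ (Fin n)) 1,
        ∀ ω' ∈ Metric.sphere (0 : EuclideanSpace ℝ (Fin n)) 1,
          ∑ i, MvPolynomial.eval (fun d => ω d) (e i)
              * MvPolynomial.eval (fun d => ω' d) (e i)
            = Polynomial.eval (⟪ω, ω'⟫) (Q j)))
    (X : Finset (EuclideanSpace ℝ (Fin n))) (hX : X.Nonempty)
    (hXs : ∀ x ∈ X, x ∈ Metric.sphere (0 : EuclideanSpace ℝ (Fin n)) 1)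
    (hanti : ∀ x ∈ X, -x ∈ X)
    (W : EuclideanSpace ℝ (Fin n) → ℝ) (hW : ∀ x ∈ X, 0 < W x)
    (hWsymm : ∀ x ∈ X, W (-x) = W x)
    (hcub : ∀ p : MvPolynomial (Fin n) ℝ, p.totalDegree ≤ 2 * l + 1 →
        ∑ x ∈ X, W x * MvPolynomial.eval (fun i => x i) p
          = ∫ ω, MvPolynomial.eval (fun i => ω i) p ∂σ)
    (htight : X.card = 2 * Nat.choose (n + l - 1) (n - 1)) :
    (∀ x ∈ X, W x = 1 / (X.card : ℝ)) ∧
    {c : ℝ | c ∈ Set.Ioo (-1 : ℝ) 1 ∧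
        ∃ x ∈ X, ∃ y ∈ X, x ≠ y ∧ x ≠ -y ∧ ⟪x, y⟫ = c}
      = {c : ℝ | Polynomial.eval c
          (∑ j ∈ Finset.range (l / 2 + 1), Q (l - 2 * j)) = 0} := by
  have hn0 : n ≠ 0 := by omega
  choose m e he using hQ
  have hE (j : ℕ) : SphericalCubature.IsZonalBasis σ j (Q j) (e j) :=
    ⟨(he j).1, fun i => (SphericalCubature.laplacian_apply _).trans ((he j).2.1 i), (he j).2.2.1,
      fun p hp hp0 => (he j).2.2.2.1 p hp ((SphericalCubature.laplacian_apply p).symm.trans hp0),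
      (he j).2.2.2.2⟩
  have hnorm : ∀ x ∈ X, ‖x‖ = 1 := fun x hx => mem_sphere_zero_iff_norm.mp (hXs x hx)
  have h0X : (0 : EuclideanSpace ℝ (Fin n)) ∉ X := fun h => by simpa using hnorm 0 h
  have hneg : ∀ x ∈ X, x ≠ -x := fun x hx h => by
    have h2 : (2 : ℝ) • x = 0 := by rw [two_smul, ← eq_neg_iff_add_eq_zero, ← h]
    rw [(smul_eq_zero.mp h2).resolve_left two_ne_zero] at hx
    exact h0X hx
  set K : Polynomial ℝ := ∑ j ∈ Finset.range (l / 2 + 1), Q (l - 2 * j) with hK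
  have key : ∀ x ∈ X, ∃ c : ℝ, c ≠ 0 ∧ c = 2 * W x * c * K.eval 1 ∧
      ∀ y ∈ X, x ≠ y → x ≠ -y → 0 = 2 * W x * c * K.eval ⟪x, y⟫ := by
    intro x hx
    obtain ⟨p, hp, hpx, hpz⟩ := SphericalCubature.exists_interpolating_polynomial hn0 h0X hanti
      htight (fun p hp hpX =>
        SphericalCubature.eq_zero_of_eval_eq_zero_on_nodes hn0 hsupp hinv hcub hp hpX) hx
    have hval : ∀ y ∈ X, MvPolynomial.eval (fun d => y d) p =
        2 * W x * MvPolynomial.eval (fun d => x d) p * K.eval ⟪x, y⟫ := by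
      intro y hy
      obtain ⟨Z, hZdeg, hZneg, hZ, hrep⟩ :=
        SphericalCubature.exists_reproducing_polynomial hn0 hsupp hinv hE l (hXs y hy)
      have hpZ : (p * Z).totalDegree ≤ 2 * l + 1 := by
        have h1 := MvPolynomial.totalDegree_mul p Z
        have h2 := hp.totalDegree_le
        omega
      have hsum := hcub (p * Z) hpZ
      simp only [map_mul] at hsum
      rw [hrep p hp] at hsum
      have hpZneg : MvPolynomial.eval (fun d => (-x) d) p * MvPolynomial.eval (fun d => (-x) d) Z =
          MvPolynomial.eval (fun d => x d) p * MvPolynomial.eval (fun d => x d) Z := by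
        rw [hZneg, ← neg_one_smul ℝ x, SphericalCubature.eval_smul_of_isHomogeneous hp,
          mul_mul_mul_comm, ← mul_pow]
        simp
      rw [← hsum, ← Finset.sum_subset (s₁ := {x, -x})]
      · rw [Finset.sum_pair (hneg x hx), hpZneg, hWsymm x hx, hZ x (hXs x hx)]
        ring
      · simp [Finset.insert_subset_iff, hx, hanti x hx]
      · intro z hz hzx
        simp only [Finset.mem_insert, Finset.mem_singleton, not_or] at hzx
        rw [hpz z hz hzx.1 hzx.2]
        ring
    refine ⟨_, hpx, ?_, fun y hy hxy hxy' => ?_⟩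
    · have := hval x hx
      rwa [real_inner_self_eq_norm_sq, hnorm x hx, one_pow] at this
    · rw [← hval y hy, hpz y hy hxy.symm fun h => hxy' (by rw [h, neg_neg])]
  have hW1 : ∀ x ∈ X, 2 * W x * K.eval 1 = 1 := by
    intro x hx
    obtain ⟨c, hc, hc1, -⟩ := key x hx
    apply mul_left_cancel₀ hc
    linarith
  have hK0 : ∀ x ∈ X, ∀ y ∈ X, x ≠ y → x ≠ -y → K.eval ⟪x, y⟫ = 0 := by
    intro x hx y hy hxy hxy'
    obtain ⟨c, hc, -, hc0⟩ := key x hx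
    have := hc0 y hy hxy hxy'
    have hWx := (hW x hx).ne'
    simpa [hc, hWx] using this
  obtain ⟨x₀, hx₀⟩ := hX
  have hK1 : K.eval 1 ≠ 0 := fun h => by simpa [h] using hW1 x₀ hx₀
  refine ⟨fun x hx => ?_, ?_⟩
  · have hconst : ∀ z ∈ X, W z = W x := fun z hz => by
      have := (hW1 z hz).trans (hW1 x hx).symm
      linarith [mul_right_cancel₀ hK1 this]
    have hsum := hcub 1 (by simp)
    simp only [map_one, mul_one, integral_const, probReal_univ, smul_eq_mul] at hsum
    rw [Finset.sum_congr rfl hconst, Finset.sum_const, nsmul_eq_mul] at hsum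
    rw [eq_div_iff (left_ne_zero_of_mul_eq_one hsum), mul_comm, hsum]
  · classical
    set B : Finset ℝ := (X.filter fun y => y ≠ x₀ ∧ y ≠ -x₀).image fun y => ⟪x₀, y⟫ with hBdef
    have hBl : l ≤ B.card := SphericalCubature.le_card_inner_products hn hsupp hinv hcub
      (hnorm x₀ hx₀) fun y hy h1 h2 =>
        Finset.mem_image_of_mem _ (Finset.mem_filter.mpr ⟨hy, h1, h2⟩)
    have hKne : K ≠ 0 := fun h => hK1 (by rw [h, Polynomial.eval_zero])
    have hKdeg : K.natDegree ≤ l :=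
      Polynomial.natDegree_sum_le_of_forall_le _ _ fun j _ =>
        ((hE (l - 2 * j)).natDegree_le hn).trans (Nat.sub_le _ _)
    have hBX : ∀ c ∈ B, ∃ y ∈ X, x₀ ≠ y ∧ x₀ ≠ -y ∧ ⟪x₀, y⟫ = c := by
      intro c hc
      obtain ⟨y, hy, rfl⟩ := Finset.mem_image.mp hc
      obtain ⟨hyX, h1, h2⟩ := Finset.mem_filter.mp hy
      exact ⟨y, hyX, h1.symm, fun h => h2 (by rw [h, neg_neg]), rfl⟩
    have hroots : B = K.roots.toFinset := by
      refine Finset.eq_of_subset_of_card_le (fun c hc => ?_) ?_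
      · obtain ⟨y, hy, h1, h2, rfl⟩ := hBX c hc
        rw [Multiset.mem_toFinset, Polynomial.mem_roots hKne]
        exact hK0 x₀ hx₀ y hy h1 h2
      · exact (Multiset.toFinset_card_le _).trans ((K.card_roots').trans (hKdeg.trans hBl))
    ext c
    constructor
    · rintro ⟨-, x, hx, y, hy, h1, h2, rfl⟩
      exact hK0 x hx y hy h1 h2
    · intro hc
      obtain ⟨y, hy, h1, h2, rfl⟩ := hBX c (by
        rw [hroots, Multiset.mem_toFinset, Polynomial.mem_roots hKne]
        exact hc)
      exact ⟨SphericalCubature.inner_mem_Ioo (hnorm x₀ hx₀) (hnorm y hy) h1 h2,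
        x₀, hx₀, y, hy, h1, h2, rfl⟩
end

section
/- Let n ≥ 3 and l ≥ 0 be integers, let X be a nonempty finite antipodal subset of 𝕊^{n-1} (X = −X), and let W : X → ℝ_{>0} be a symmetric weight (W(−x) = W(x)) with ∑_{x∈X} W(x) = 1. For x ∈ 𝕊^{n-1}, let s_x ∈ O(n) be the reflection s_x(y) = y − 2⟨x,y⟩x and let π^{(l)} be the representation of O(n) on H^{(l)}(𝕊^{n-1}) given by (π^{(l)}(g)φ)(ω) = φ(g^{-1}ω). If the operator ∑_{x∈X} W(x)·π^{(l)}(s_x) on H^{(l)}(𝕊^{n-1}) is a scalar multiple of the identity, then (X,W) is a cubature formula of strength 2l+1 on 𝕊^{n-1}. -/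
open MeasureTheory Finset
open scoped RealInnerProductSpace

section ComplexPower

variable {R : Type*} [CommRing R]

/-- The formal real and imaginary parts of `(A + i B) ^ m`. -/
def complexPowParts (A B : R) : ℕ → R × R
  | 0 => (1, 0)
  | m + 1 =>
    (A * (complexPowParts A B m).1 - B * (complexPowParts A B m).2,
      A * (complexPowParts A B m).2 + B * (complexPowParts A B m).1)

theorem derivation_complexPowParts {S : Type*} [CommRing S] [Algebra S R] (D : Derivation S R R)
    (A B : R) (m : ℕ) :
    D (complexPowParts A B (m + 1)).1 =
        (m + 1) * (D A * (complexPowParts A B m).1 - D B * (complexPowParts A B m).2) ∧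
      D (complexPowParts A B (m + 1)).2 =
        (m + 1) * (D A * (complexPowParts A B m).2 + D B * (complexPowParts A B m).1) := by
  induction m with
  | zero => simp [complexPowParts]
  | succ m ih =>
    have h1 : complexPowParts A B (m + 1 + 1) =
      (A * (complexPowParts A B (m + 1)).1 - B * (complexPowParts A B (m + 1)).2,
        A * (complexPowParts A B (m + 1)).2 + B * (complexPowParts A B (m + 1)).1) := rfl
    rw [h1]
    simp only [map_sub, map_add, Derivation.leibniz, smul_eq_mul, ih.1, ih.2]
    simp only [complexPowParts]
    push_cast
    constructor <;> ring

theorem ofReal_complexPowParts (f : R →+* ℝ) (A B : R) (m : ℕ) :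
    ((f (complexPowParts A B m).1 : ℝ) : ℂ) + (f (complexPowParts A B m).2 : ℝ) * Complex.I =
      ((f A : ℝ) + (f B : ℝ) * Complex.I) ^ m := by
  induction m with
  | zero => simp [complexPowParts]
  | succ m ih =>
    rw [pow_succ, ← ih]
    simp only [complexPowParts, map_sub, map_add, map_mul]
    push_cast
    linear_combination (-(f B : ℂ) * (f (complexPowParts A B m).2 : ℂ)) * Complex.I_sq

end ComplexPower

namespace MvPolynomial

theorem isHomogeneous_complexPowParts {ι : Type*} {A B : MvPolynomial ι ℝ}
    (hA : A.IsHomogeneous 1) (hB : B.IsHomogeneous 1) (m : ℕ) :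
    (complexPowParts A B m).1.IsHomogeneous m ∧ (complexPowParts A B m).2.IsHomogeneous m := by
  induction m with
  | zero => exact ⟨isHomogeneous_one _ _, isHomogeneous_zero _ _ _⟩
  | succ m ih =>
    simp only [complexPowParts]
    rw [add_comm m 1]
    exact ⟨(hA.mul ih.1).sub (hB.mul ih.2), (hA.mul ih.2).add (hB.mul ih.1)⟩

/-- The linear form with coefficient vector `a`. -/
noncomputable def linearForm {ι : Type*} [Fintype ι] {K : Type*} [CommSemiring K] (a : ι → K) :
    MvPolynomial ι K := ∑ i, C (a i) * X i

variable {ι : Type*} [Fintype ι]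

@[simp]
theorem eval_linearForm {K : Type*} [CommSemiring K] (a u : ι → K) :
    eval u (linearForm a) = ∑ i, a i * u i := by
  simp [linearForm]

theorem isHomogeneous_linearForm {K : Type*} [CommSemiring K] (a : ι → K) :
    (linearForm a).IsHomogeneous 1 :=
  IsHomogeneous.sum _ _ _ fun i _ => by
    simpa using (isHomogeneous_C ι (a i)).mul (isHomogeneous_X K i)

theorem pderiv_linearForm {K : Type*} [CommSemiring K] (a : ι → K) (i : ι) :
    pderiv i (linearForm a) = C (a i) := by
  classical
  simp [linearForm, pderiv_X, Pi.single_apply]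

theorem harmonic_complexPowParts {a b : ι → ℝ} (hab : ∑ i, a i * b i = 0)
    (haabb : ∑ i, a i * a i = ∑ i, b i * b i) (m : ℕ) :
    ∑ i, pderiv i (pderiv i (complexPowParts (linearForm a) (linearForm b) m).1) = 0 ∧
      ∑ i, pderiv i (pderiv i (complexPowParts (linearForm a) (linearForm b) m).2) = 0 := by
  rcases m with _ | _ | m
  · simp [complexPowParts]
  · simp [complexPowParts, pderiv_linearForm]
  · have h1 : ∑ i, (C (a i) * C (b i) : MvPolynomial ι ℝ) = 0 := by
      simp_rw [← C_mul, ← map_sum, hab, map_zero]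
    have h2 : ∑ i, (C (a i) * C (a i) - C (b i) * C (b i) : MvPolynomial ι ℝ) = 0 := by
      simp_rw [← C_mul, ← C_sub, ← map_sum, Finset.sum_sub_distrib, haabb, sub_self, map_zero]
    have hcast : ∀ (i : ι) (p : MvPolynomial ι ℝ),
        pderiv i (((m + 1 : ℕ) + 1 : MvPolynomial ι ℝ) * p) =
          ((m + 1 : ℕ) + 1 : MvPolynomial ι ℝ) * pderiv i p := by
      intro i p
      rw [pderiv_mul]
      simp
    have hd := fun i => derivation_complexPowParts (pderiv (R := ℝ) i)
      (linearForm a) (linearForm b)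
    simp only [(hd _ _).1, (hd _ _).2, hcast, pderiv_linearForm, map_sub, map_add, pderiv_C_mul]
    set p := (complexPowParts (linearForm a) (linearForm b) m).1
    set q := (complexPowParts (linearForm a) (linearForm b) m).2
    constructor
    · calc _ = ((m + 1 : ℕ) + 1 : MvPolynomial ι ℝ) * (m + 1) *
            ((∑ i, (C (a i) * C (a i) - C (b i) * C (b i))) * p -
              2 * (∑ i, C (a i) * C (b i)) * q) := by
            simp only [Finset.sum_mul, Finset.mul_sum, ← Finset.sum_sub_distrib]
            exact Finset.sum_congr rfl fun i _ => by ring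
        _ = 0 := by rw [h1, h2]; ring
    · calc _ = ((m + 1 : ℕ) + 1 : MvPolynomial ι ℝ) * (m + 1) *
            ((∑ i, (C (a i) * C (a i) - C (b i) * C (b i))) * q +
              2 * (∑ i, C (a i) * C (b i)) * p) := by
            simp only [Finset.sum_mul, Finset.mul_sum, ← Finset.sum_add_distrib]
            exact Finset.sum_congr rfl fun i _ => by ring
        _ = 0 := by rw [h1, h2]; ring

theorem IsHomogeneous.eval_const_mul {K : Type*} [CommSemiring K] {p : MvPolynomial ι K} {d : ℕ}
    (hp : p.IsHomogeneous d) (r : K) (x : ι → K) :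
    eval (fun i => r * x i) p = r ^ d * eval x p := by
  rw [eval_eq', eval_eq', Finset.mul_sum]
  refine Finset.sum_congr rfl fun m hm => ?_
  have hd : ∑ i, m i = d := by
    rw [← Finsupp.degree_eq_sum, Finsupp.degree_eq_weight_one]
    exact hp (mem_support_iff.1 hm)
  simp only [mul_pow, Finset.prod_mul_distrib, Finset.prod_pow_eq_pow_sum, hd]
  ring

/-- A linear functional killing all `d`-th powers of linear forms kills all forms of degree `d`. -/
theorem eq_zero_of_linearForm_pow (D : MvPolynomial ι ℝ →ₗ[ℝ] ℝ) (d : ℕ)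
    (hD : ∀ u : ι → ℝ, D (linearForm u ^ d) = 0) {p : MvPolynomial ι ℝ}
    (hp : p.IsHomogeneous d) : D p = 0 := by
  classical
  let H : MvPolynomial ι ℝ := ∑ k ∈ piAntidiag univ d,
    monomial (Finsupp.equivFunOnFinite.symm k)
      (Nat.multinomial univ k * D (monomial (Finsupp.equivFunOnFinite.symm k) 1))
  have hH : H = 0 := by
    refine MvPolynomial.funext fun u => ?_
    rw [map_zero, ← hD u, linearForm, Finset.sum_pow_eq_sum_piAntidiag, map_sum, map_sum]
    refine Finset.sum_congr rfl fun k _ => ?_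
    have : (Nat.multinomial univ k : MvPolynomial ι ℝ) * ∏ i, (C (u i) * X i) ^ k i =
        (Nat.multinomial univ k * ∏ i, u i ^ k i : ℝ) •
          monomial (Finsupp.equivFunOnFinite.symm k) (1 : ℝ) := by
      rw [monomial_eq, smul_eq_C_mul]
      simp [mul_pow, Finset.prod_mul_distrib, Finsupp.prod_fintype, mul_assoc]
    rw [this, map_smul, eval_monomial, smul_eq_mul, Finsupp.prod_fintype _ _ (by simp)]
    simp only [Finsupp.equivFunOnFinite_symm_apply_apply]
    ring
  have hmon : ∀ m : ι →₀ ℕ, m.degree = d → D (monomial m 1) = 0 := by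
    intro m hm
    have hc : coeff m H = 0 := by rw [hH, coeff_zero]
    have hmem : (m : ι → ℕ) ∈ piAntidiag univ d := by
      simpa [Finsupp.degree_eq_sum] using hm
    simp only [H, coeff_sum, coeff_monomial] at hc
    rw [Finset.sum_eq_single (m : ι → ℕ) (fun k _ hk => if_neg fun h => hk (by simp [← h]))
      (fun h => absurd hmem h)] at hc
    have hpos : (Nat.multinomial univ (m : ι → ℕ) : ℝ) ≠ 0 :=
      Nat.cast_ne_zero.2 (Nat.multinomial_pos _ _).ne'
    simpa [hpos] using hc
  rw [p.as_sum, map_sum]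
  refine Finset.sum_eq_zero fun m hm => ?_
  have : monomial m (coeff m p) = coeff m p • monomial m (1 : ℝ) := by
    rw [smul_monomial, smul_eq_mul, mul_one]
  have hd : m.degree = d := by
    rw [Finsupp.degree_eq_weight_one]; exact hp (mem_support_iff.1 hm)
  rw [this, map_smul, hmon m hd, smul_zero]

/-- For at least two variables, a polynomial vanishing at all nonzero isotropic vectors is a
multiple of the quadratic form. -/
theorem sum_sq_dvd_of_eval_isotropic {n : ℕ} (hn : 2 ≤ n) {P : MvPolynomial (Fin n) ℂ}
    (hP : ∀ z : Fin n → ℂ, z ≠ 0 → ∑ i, z i ^ 2 = 0 → eval z P = 0) :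
    (∑ i, X i ^ 2 : MvPolynomial (Fin n) ℂ) ∣ P := by
  obtain ⟨m, rfl⟩ : ∃ m, n = m + 1 := ⟨n - 1, by omega⟩
  set s : MvPolynomial (Fin m) ℂ := ∑ i, X i ^ 2 with hs
  set Q : Polynomial (MvPolynomial (Fin m) ℂ) := Polynomial.X ^ 2 + Polynomial.C s with hQ
  have hφ : finSuccEquiv ℂ m (∑ i, X i ^ 2) = Q := by
    rw [Fin.sum_univ_succ]
    simp [hQ, hs, finSuccEquiv_X_zero, finSuccEquiv_X_succ]
  have hmonic : Q.Monic := Polynomial.monic_X_pow_add_C s two_ne_zero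
  have hQdeg : Q.natDegree = 2 := Polynomial.natDegree_X_pow_add_C
  set R := finSuccEquiv ℂ m P %ₘ Q with hR
  have hRdeg : R.natDegree ≤ 1 := by
    have := Polynomial.natDegree_modByMonic_lt (finSuccEquiv ℂ m P) hmonic
      (fun h => by rw [h] at hQdeg; simp at hQdeg)
    rw [← hR] at this
    omega
  have hroot : ∀ (x : Fin m → ℂ) (r : ℂ), r ^ 2 + eval x s = 0 → r ≠ 0 →
      eval x (R.coeff 1) * r + eval x (R.coeff 0) = 0 := by
    intro x r hr hr0
    have h0 : eval (Fin.cons r x : Fin (m + 1) → ℂ) P = 0 := by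
      refine hP _ (fun h => hr0 (by simpa using congrFun h 0)) ?_
      rw [Fin.sum_univ_succ]
      simpa [hs] using hr
    rw [eval_eq_eval_mv_eval', ← Polynomial.modByMonic_add_div (finSuccEquiv ℂ m P) Q,
      ← hR, Polynomial.eq_X_add_C_of_natDegree_le_one hRdeg] at h0
    simpa [hQ, hr] using h0
  have hpair : ∀ x : Fin m → ℂ, eval x s ≠ 0 →
      eval x (R.coeff 1) = 0 ∧ eval x (R.coeff 0) = 0 := by
    intro x hx
    obtain ⟨r, hr⟩ := IsAlgClosed.exists_pow_nat_eq (-eval x s) two_pos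
    have hr0 : r ≠ 0 := by
      rintro rfl
      exact hx (by simpa using hr)
    have h1 := hroot x r (by rw [hr]; ring) hr0
    have h2 := hroot x (-r) (by rw [neg_sq, hr]; ring) (neg_ne_zero.2 hr0)
    have h3 : eval x (R.coeff 0) = 0 := by linear_combination (h1 + h2) / 2
    refine ⟨?_, h3⟩
    rw [h3, add_zero] at h1
    exact (mul_eq_zero.1 h1).resolve_right hr0
  have hs0 : s ≠ 0 := by
    intro h
    have := congrArg (eval (Pi.single (⟨0, by omega⟩ : Fin m) (1 : ℂ))) h
    simp [hs, Pi.single_apply] at this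
  have hcoef : ∀ k : MvPolynomial (Fin m) ℂ, (∀ x, eval x s ≠ 0 → eval x k = 0) → k = 0 := by
    intro k hk
    have : s * k = 0 := MvPolynomial.funext fun x => by
      by_cases hx : eval x s = 0
      · simp [hx]
      · simp [hk x hx]
    exact (mul_eq_zero.1 this).resolve_left hs0
  have hR0 : R = 0 := by
    rw [Polynomial.eq_X_add_C_of_natDegree_le_one hRdeg,
      hcoef _ fun x hx => (hpair x hx).1, hcoef _ fun x hx => (hpair x hx).2]
    simp
  have := (Polynomial.modByMonic_eq_zero_iff_dvd hmonic).1 (hR.symm.trans hR0)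
  rw [← hφ] at this
  exact (map_dvd_iff (finSuccEquiv ℂ m)).1 this

end MvPolynomial

theorem Polynomial.coeff_linear_pow {R : Type*} [CommSemiring R] (α β : R) (d j : ℕ) :
    ((Polynomial.C α + Polynomial.C β * Polynomial.X) ^ d).coeff j =
      d.choose j * α ^ (d - j) * β ^ j := by
  have : (Polynomial.C α + Polynomial.C β * Polynomial.X) ^ d =
      ((Polynomial.X + Polynomial.C α) ^ d).comp (Polynomial.C β * Polynomial.X) := by
    simp [add_comm]
  rw [this, Polynomial.comp_C_mul_X_coeff, Polynomial.coeff_X_add_C_pow]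
  ring

theorem EuclideanSpace.real_inner_eq_sum {n : ℕ} (u v : EuclideanSpace ℝ (Fin n)) :
    ⟪u, v⟫ = ∑ i, u i * v i := by
  simp [PiLp.inner_apply, mul_comm]

section SphereMeasure

variable {n : ℕ} {σ : Measure (EuclideanSpace ℝ (Fin n))}

theorem ae_norm_eq_one
    (hsupp : σ (Metric.sphere (0 : EuclideanSpace ℝ (Fin n)) 1)ᶜ = 0) : ∀ᵐ u ∂σ, ‖u‖ = 1 := by
  have : ∀ᵐ u ∂σ, u ∈ Metric.sphere (0 : EuclideanSpace ℝ (Fin n)) 1 := hsupp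
  filter_upwards [this] with u hu using by simpa using hu

theorem integrable_of_continuous_of_sphere [IsFiniteMeasure σ]
    (hsupp : σ (Metric.sphere (0 : EuclideanSpace ℝ (Fin n)) 1)ᶜ = 0)
    {F : Type*} [NormedAddCommGroup F] {f : EuclideanSpace ℝ (Fin n) → F} (hf : Continuous f) :
    Integrable f σ := by
  have h := hf.continuousOn.integrableOn_compact (μ := σ)
    (isCompact_sphere (0 : EuclideanSpace ℝ (Fin n)) 1)
  rwa [IntegrableOn, Measure.restrict_eq_self_of_ae_mem] at h
  exact hsupp

theorem integral_inner_pow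
    (hinv : ∀ g : EuclideanSpace ℝ (Fin n) ≃ₗᵢ[ℝ] EuclideanSpace ℝ (Fin n),
      MeasurePreserving g σ σ)
    (d : ℕ) {e : EuclideanSpace ℝ (Fin n)} (he : ‖e‖ = 1) (y : EuclideanSpace ℝ (Fin n)) :
    ∫ u, ⟪u, y⟫ ^ d ∂σ = ‖y‖ ^ d * ∫ u, ⟪u, e⟫ ^ d ∂σ := by
  have hnorm : ‖‖y‖ • e‖ = ‖y‖ := by simp [norm_smul, he]
  set g := (ℝ ∙ (‖y‖ • e - y))ᗮ.reflection
  have hg : g (‖y‖ • e) = y := Submodule.reflection_sub hnorm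
  rw [← (hinv g).integral_comp g.toHomeomorph.measurableEmbedding, ← integral_const_mul]
  refine integral_congr_ae (Filter.Eventually.of_forall fun u => ?_)
  have : ⟪g u, y⟫ = ‖y‖ * ⟪u, e⟫ := by
    conv_lhs => rw [← hg]
    rw [LinearIsometryEquiv.inner_map_map, inner_smul_right]
  simp only [this, mul_pow]

theorem integral_inner_pow_pos [IsProbabilityMeasure σ]
    (hsupp : σ (Metric.sphere (0 : EuclideanSpace ℝ (Fin n)) 1)ᶜ = 0)
    (hinv : ∀ g : EuclideanSpace ℝ (Fin n) ≃ₗᵢ[ℝ] EuclideanSpace ℝ (Fin n),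
      MeasurePreserving g σ σ)
    (k : ℕ) {e : EuclideanSpace ℝ (Fin n)} (he : ‖e‖ = 1) :
    0 < ∫ u, ⟪u, e⟫ ^ (2 * k) ∂σ := by
  rcases Nat.eq_zero_or_pos k with rfl | hk
  · simp
  have hnn : ∀ y u : EuclideanSpace ℝ (Fin n), 0 ≤ ⟪u, y⟫ ^ (2 * k) := fun y u =>
    (even_two_mul k).pow_nonneg _
  refine (integral_nonneg (hnn e)).lt_of_ne' fun h0 => ?_
  have hz : ∀ y : EuclideanSpace ℝ (Fin n), ∀ᵐ u ∂σ, ⟪u, y⟫ = 0 := by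
    intro y
    have h := integral_inner_pow (σ := σ) hinv (2 * k) he y
    rw [h0, mul_zero, integral_eq_zero_iff_of_nonneg (hnn y)
      (integrable_of_continuous_of_sphere hsupp (by fun_prop))] at h
    filter_upwards [h] with u hu
    exact (pow_eq_zero_iff (by omega)).1 hu
  have hall : ∀ᵐ u ∂σ, ∀ i : Fin n, ⟪u, EuclideanSpace.single i (1 : ℝ)⟫ = 0 :=
    ae_all_iff.2 fun i => hz _
  obtain ⟨u, hu, hu1⟩ := (hall.and (ae_norm_eq_one hsupp)).exists
  have : u = 0 := by
    ext i
    simpa [EuclideanSpace.inner_single_right] using hu i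
  simp [this] at hu1

end SphereMeasure

section Isotropic

variable {n : ℕ} {a b : EuclideanSpace ℝ (Fin n)}

/-- The orthogonal projection to the complement of an orthogonal pair `a`, `b` of equal norm. -/
noncomputable def pairComplProj (a b u : EuclideanSpace ℝ (Fin n)) : EuclideanSpace ℝ (Fin n) :=
  u - (⟪a, u⟫ / ‖a‖ ^ 2) • a - (⟪b, u⟫ / ‖a‖ ^ 2) • b

theorem continuous_pairComplProj : Continuous (pairComplProj a b) := by
  unfold pairComplProj
  fun_prop

theorem inner_pairComplProj_comm (u x : EuclideanSpace ℝ (Fin n)) :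
    ⟪pairComplProj a b u, x⟫ = ⟪u, pairComplProj a b x⟫ := by
  simp only [pairComplProj, inner_sub_left, inner_sub_right, inner_smul_left, inner_smul_right,
    real_inner_comm u a, real_inner_comm u b, RCLike.conj_to_real]
  ring

theorem inner_left_pairComplProj (ha : a ≠ 0) (hab : ⟪a, b⟫ = 0) (u : EuclideanSpace ℝ (Fin n)) :
    ⟪a, pairComplProj a b u⟫ = 0 := by
  have : ‖a‖ ≠ 0 := norm_ne_zero_iff.2 ha
  simp only [pairComplProj, inner_sub_right, inner_smul_right, hab, real_inner_self_eq_norm_sq]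
  field_simp
  ring

theorem inner_right_pairComplProj (ha : a ≠ 0) (hab : ⟪a, b⟫ = 0) (hn : ‖a‖ = ‖b‖)
    (u : EuclideanSpace ℝ (Fin n)) : ⟪b, pairComplProj a b u⟫ = 0 := by
  have : ‖a‖ ≠ 0 := norm_ne_zero_iff.2 ha
  simp only [pairComplProj, inner_sub_right, inner_smul_right, real_inner_comm a b, hab,
    real_inner_self_eq_norm_sq, ← hn]
  field_simp
  ring

theorem norm_sq_mul_norm_pairComplProj_sq (ha : a ≠ 0) (hab : ⟪a, b⟫ = 0) (hn : ‖a‖ = ‖b‖)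
    (u : EuclideanSpace ℝ (Fin n)) :
    ‖a‖ ^ 2 * ‖pairComplProj a b u‖ ^ 2 = ‖a‖ ^ 2 * ‖u‖ ^ 2 - (⟪a, u⟫ ^ 2 + ⟪b, u⟫ ^ 2) := by
  have h0 : ‖a‖ ≠ 0 := norm_ne_zero_iff.2 ha
  have : ‖pairComplProj a b u‖ ^ 2 = ⟪u, pairComplProj a b u⟫ := by
    rw [← real_inner_self_eq_norm_sq]
    conv_lhs => enter [2]; rw [pairComplProj]
    rw [inner_sub_left, inner_sub_left, inner_smul_left, inner_smul_left,
      inner_left_pairComplProj ha hab, inner_right_pairComplProj ha hab hn]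
    simp
  rw [this]
  simp only [pairComplProj, inner_sub_right, inner_smul_right, real_inner_self_eq_norm_sq,
    real_inner_comm a u, real_inner_comm b u]
  field_simp
  ring

theorem integral_norm_pairComplProj_pow_pos (h3 : 3 ≤ n)
    {σ : Measure (EuclideanSpace ℝ (Fin n))} [IsProbabilityMeasure σ]
    (hsupp : σ (Metric.sphere (0 : EuclideanSpace ℝ (Fin n)) 1)ᶜ = 0)
    (hinv : ∀ g : EuclideanSpace ℝ (Fin n) ≃ₗᵢ[ℝ] EuclideanSpace ℝ (Fin n),
      MeasurePreserving g σ σ) (a b : EuclideanSpace ℝ (Fin n)) (k : ℕ) :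
    0 < ∫ u, ‖pairComplProj a b u‖ ^ (2 * k) ∂σ := by
  classical
  obtain ⟨e, hespan, he⟩ : ∃ e ∈ (Submodule.span ℝ ({a, b} : Set (EuclideanSpace ℝ (Fin n))))ᗮ,
      ‖e‖ = 1 := by
    have h2 : Module.finrank ℝ
        (Submodule.span ℝ ({a, b} : Set (EuclideanSpace ℝ (Fin n)))) ≤ 2 := by
      have := finrank_span_finset_le_card (R := ℝ) ({a, b} : Finset (EuclideanSpace ℝ (Fin n)))
      rw [Finset.coe_pair] at this
      exact this.trans Finset.card_le_two
    have hsum := (Submodule.span ℝ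
      ({a, b} : Set (EuclideanSpace ℝ (Fin n)))).finrank_add_finrank_orthogonal
    rw [finrank_euclideanSpace_fin] at hsum
    have : Nontrivial (Submodule.span ℝ ({a, b} : Set (EuclideanSpace ℝ (Fin n))))ᗮ :=
      Module.nontrivial_of_finrank_pos (R := ℝ) (by omega)
    obtain ⟨v, hv⟩ := exists_ne
      (0 : (Submodule.span ℝ ({a, b} : Set (EuclideanSpace ℝ (Fin n))))ᗮ)
    refine ⟨‖(v : EuclideanSpace ℝ (Fin n))‖⁻¹ • (v : EuclideanSpace ℝ (Fin n)),
      Submodule.smul_mem _ _ v.2, norm_smul_inv_norm (𝕜 := ℝ) ?_⟩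
    simpa using hv
  have hae : ⟪a, e⟫ = 0 := (Submodule.mem_orthogonal _ _).1 hespan a
    (Submodule.subset_span (by simp))
  have hbe : ⟪b, e⟫ = 0 := (Submodule.mem_orthogonal _ _).1 hespan b
    (Submodule.subset_span (by simp))
  refine (integral_inner_pow_pos hsupp hinv k he).trans_le (integral_mono
    (integrable_of_continuous_of_sphere hsupp (by fun_prop))
    (integrable_of_continuous_of_sphere hsupp (continuous_pairComplProj.norm.pow _)) fun u => ?_)
  have h1 : ⟪u, e⟫ = ⟪pairComplProj a b u, e⟫ := by
    rw [inner_pairComplProj_comm, pairComplProj, hae, hbe]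
    simp
  have h2 : |⟪u, e⟫| ≤ ‖pairComplProj a b u‖ := by
    rw [h1]
    simpa [he] using abs_real_inner_le_norm (pairComplProj a b u) e
  show ⟪u, e⟫ ^ (2 * k) ≤ _
  rw [← (even_two_mul k).pow_abs]
  gcongr

/-- The value at `x` of the complex linear form with coefficient vector `a + i b`. -/
noncomputable def complexForm (a b x : EuclideanSpace ℝ (Fin n)) : ℂ :=
  (⟪a, x⟫ : ℝ) + (⟪b, x⟫ : ℝ) * Complex.I

theorem sum_complexForm_reflection_pow {l : ℕ} {X : Finset (EuclideanSpace ℝ (Fin n))}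
    {W : EuclideanSpace ℝ (Fin n) → ℝ} {c : ℝ}
    (hscalar : ∀ p : MvPolynomial (Fin n) ℝ, p.IsHomogeneous l →
      (∑ i : Fin n, MvPolynomial.pderiv i (MvPolynomial.pderiv i p)) = 0 →
      ∀ ω ∈ Metric.sphere (0 : EuclideanSpace ℝ (Fin n)) 1,
        ∑ x ∈ X, W x * MvPolynomial.eval (fun i => (ω - (2 * ⟪x, ω⟫) • x) i) p
          = c * MvPolynomial.eval (fun i => ω i) p)
    (hab : ⟪a, b⟫ = 0) (hn : ‖a‖ = ‖b‖) {ω : EuclideanSpace ℝ (Fin n)} (hω : ‖ω‖ = 1) :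
    ∑ x ∈ X, (W x : ℂ) * complexForm a b (ω - (2 * ⟪x, ω⟫) • x) ^ l =
      c * complexForm a b ω ^ l := by
  have hin := EuclideanSpace.real_inner_eq_sum (n := n)
  have hab' : ∑ i, a i * b i = 0 := by rw [← hin, hab]
  have haabb : ∑ i, a i * a i = ∑ i, b i * b i := by
    rw [← hin, ← hin, real_inner_self_eq_norm_sq, real_inner_self_eq_norm_sq, hn]
  have hhom := MvPolynomial.isHomogeneous_complexPowParts
    (MvPolynomial.isHomogeneous_linearForm a) (MvPolynomial.isHomogeneous_linearForm b) l
  have hharm := MvPolynomial.harmonic_complexPowParts hab' haabb l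
  have hre := hscalar _ hhom.1 hharm.1 ω (by simpa using hω)
  have him := hscalar _ hhom.2 hharm.2 ω (by simpa using hω)
  have hpow : ∀ v : EuclideanSpace ℝ (Fin n), complexForm a b v ^ l =
      (MvPolynomial.eval (fun i => v i) (complexPowParts (MvPolynomial.linearForm a)
        (MvPolynomial.linearForm b) l).1 : ℝ) +
      (MvPolynomial.eval (fun i => v i) (complexPowParts (MvPolynomial.linearForm a)
        (MvPolynomial.linearForm b) l).2 : ℝ) * Complex.I := by
    intro v
    rw [ofReal_complexPowParts (MvPolynomial.eval fun i => v i), MvPolynomial.eval_linearForm,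
      MvPolynomial.eval_linearForm, ← hin, ← hin, complexForm]
  simp only [hpow, mul_add, ← mul_assoc, Finset.sum_add_distrib, ← Finset.sum_mul,
    ← Complex.ofReal_mul, ← Complex.ofReal_sum]
  rw [hre, him]

theorem sum_complexForm_pow_mul_eq_zero {l : ℕ} {X : Finset (EuclideanSpace ℝ (Fin n))}
    {W : EuclideanSpace ℝ (Fin n) → ℝ} {c : ℝ}
    (ha : a ≠ 0) (hab : ⟪a, b⟫ = 0) (hn : ‖a‖ = ‖b‖)
    (h : ∀ ω : EuclideanSpace ℝ (Fin n), ‖ω‖ = 1 →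
      ∑ x ∈ X, (W x : ℂ) * complexForm a b (ω - (2 * ⟪x, ω⟫) • x) ^ l =
        c * complexForm a b ω ^ l)
    {j : ℕ} (hj : 1 ≤ j) (hjl : j ≤ l) :
    ∑ x ∈ X, (W x : ℂ) * complexForm a b x ^ (2 * j) *
      ((‖a‖ ^ 2 - (⟪a, x⟫ ^ 2 + ⟪b, x⟫ ^ 2) : ℝ) : ℂ) ^ (l - j) = 0 := by
  have h0 : ‖a‖ ≠ 0 := norm_ne_zero_iff.2 ha
  have h0' : (‖a‖ : ℂ) ≠ 0 := Complex.ofReal_ne_zero.2 h0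
  let α : EuclideanSpace ℝ (Fin n) → ℂ := fun x =>
    ((‖a‖ ^ 2 - (⟪a, x⟫ ^ 2 + ⟪b, x⟫ ^ 2) : ℝ) : ℂ)
  let Q : Polynomial ℂ := ∑ x ∈ X, Polynomial.C (W x : ℂ) *
      (Polynomial.C (α x) + Polynomial.C (-complexForm a b x ^ 2) * Polynomial.X) ^ l -
    Polynomial.C (c * (‖a‖ : ℂ) ^ (2 * l))
  have hroot : ∀ e : ℂ, ‖e‖ = 1 → Q.eval (e ^ 2) = 0 := by
    intro e he
    have hee : (e.re : ℂ) ^ 2 + (e.im : ℂ) ^ 2 = 1 := by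
      have : e.re * e.re + e.im * e.im = 1 := by
        rw [← Complex.normSq_apply, Complex.normSq_eq_norm_sq, he, one_pow]
      exact_mod_cast (by linarith : e.re ^ 2 + e.im ^ 2 = 1)
    have hee' : e.re ^ 2 + e.im ^ 2 = 1 := by exact_mod_cast hee
    -- the point of the unit circle of the plane of `a`, `b` with argument `-arg e`
    set ω : EuclideanSpace ℝ (Fin n) := (e.re / ‖a‖) • a - (e.im / ‖a‖) • b with hω
    have haω : ⟪a, ω⟫ = ‖a‖ * e.re := by
      simp only [hω, inner_sub_right, inner_smul_right, hab, real_inner_self_eq_norm_sq]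
      field_simp
      ring
    have hbω : ⟪b, ω⟫ = -(‖a‖ * e.im) := by
      simp only [hω, inner_sub_right, inner_smul_right, real_inner_comm a b, hab,
        real_inner_self_eq_norm_sq, ← hn]
      field_simp
      ring
    have hωn : ‖ω‖ = 1 := by
      have : ‖ω‖ ^ 2 = 1 := by
        rw [← real_inner_self_eq_norm_sq]
        conv_lhs => enter [2]; rw [hω]
        rw [inner_sub_left, inner_smul_left, inner_smul_left, haω, hbω, ← hee']
        simp only [RCLike.conj_to_real]
        field_simp
        ring
      exact (pow_eq_one_iff_of_nonneg (norm_nonneg _) two_ne_zero).1 this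
    have hx : ∀ x, e * ‖a‖ * complexForm a b (ω - (2 * ⟪x, ω⟫) • x) =
        α x + (-complexForm a b x ^ 2) * e ^ 2 := by
      intro x
      have hxω : ‖a‖ * ⟪x, ω⟫ = e.re * ⟪a, x⟫ - e.im * ⟪b, x⟫ := by
        simp only [hω, inner_sub_right, inner_smul_right, real_inner_comm a x,
          real_inner_comm b x]
        field_simp
      have hxω' : (‖a‖ : ℂ) * (⟪x, ω⟫ : ℝ) = e.re * (⟪a, x⟫ : ℝ) - e.im * (⟪b, x⟫ : ℝ) := by
        exact_mod_cast hxω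
      have hI := Complex.I_sq
      simp only [complexForm, α, inner_sub_right, inner_smul_right, haω, hbω]
      rw [← Complex.re_add_im e]
      simp only [Complex.add_re, Complex.ofReal_re, Complex.mul_re, Complex.I_re, mul_zero,
        Complex.ofReal_im, Complex.I_im, mul_one, sub_self, add_zero, Complex.add_im,
        Complex.mul_im, zero_add]
      push_cast
      generalize (e.re : ℂ) = s at *
      generalize (e.im : ℂ) = t at *
      generalize ((⟪a, x⟫ : ℝ) : ℂ) = A at *
      generalize ((⟪b, x⟫ : ℝ) : ℂ) = B at *
      generalize ((⟪x, ω⟫ : ℝ) : ℂ) = Y at *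
      generalize (‖a‖ : ℂ) = r at *
      linear_combination (-2 * (s + t * Complex.I) * (A + B * Complex.I)) * hxω' +
        (r ^ 2 - (A ^ 2 + B ^ 2)) * hee +
        (-r ^ 2 * t ^ 2 + (A * t + B * s) ^ 2 + 2 * (A * t + B * s) * Complex.I * B * t +
          B ^ 2 * t ^ 2 * (Complex.I ^ 2 + 1)) * hI
    have key := congrArg (fun y => (e * ‖a‖) ^ l * y) (h ω hωn)
    simp only [Finset.mul_sum] at key
    have hωZ : e * ‖a‖ * complexForm a b ω = (‖a‖ : ℂ) ^ 2 := by
      simp only [complexForm, haω, hbω]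
      conv_lhs => enter [1, 1]; rw [← Complex.re_add_im e]
      push_cast
      linear_combination (‖a‖ : ℂ) ^ 2 * hee - (‖a‖ : ℂ) ^ 2 * (e.im : ℂ) ^ 2 * Complex.I_sq
    simp only [Q, Polynomial.eval_sub, Polynomial.eval_finsetSum, Polynomial.eval_mul,
      Polynomial.eval_C, Polynomial.eval_pow, Polynomial.eval_add, Polynomial.eval_X, ← hx]
    rw [sub_eq_zero, pow_mul, ← hωZ, mul_pow _ (complexForm a b ω)]
    calc _ = _ := Finset.sum_congr rfl fun x _ => by rw [mul_pow]; ring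
      _ = _ := key
      _ = _ := by ring
  have hQ : Q = 0 := by
    refine Polynomial.eq_zero_of_infinite_isRoot Q (Set.Infinite.mono (s := Metric.sphere 0 1) ?_ ?_)
    · intro τ hτ
      obtain ⟨e, he⟩ := IsAlgClosed.exists_pow_nat_eq τ two_pos
      have he1 : ‖e‖ = 1 := by
        have : ‖e‖ ^ 2 = 1 := by rw [← norm_pow, he]; simpa using hτ
        exact (pow_eq_one_iff_of_nonneg (norm_nonneg _) two_ne_zero).1 this
      show Q.eval τ = 0
      rw [← he, hroot e he1]
    · refine (isPreconnected_sphere (by rw [Complex.rank_real_complex]; norm_num) 0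
        1).infinite_of_nontrivial ⟨1, by simp, -1, by simp, fun h => ?_⟩
      have := congrArg Complex.re h
      norm_num at this
  have hc : Q.coeff j = 0 := by rw [hQ, Polynomial.coeff_zero]
  simp only [Q, Polynomial.coeff_sub, Polynomial.finsetSum_coeff, Polynomial.coeff_C_mul,
    Polynomial.coeff_linear_pow, Polynomial.coeff_C_of_ne_zero (show j ≠ 0 by omega), sub_zero] at hc
  have hch : ((l.choose j : ℂ) * (-1) ^ j) ≠ 0 :=
    mul_ne_zero (Nat.cast_ne_zero.2 (Nat.choose_pos hjl).ne') (pow_ne_zero _ (by norm_num))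
  refine (mul_eq_zero.1 (?_ : ((l.choose j : ℂ) * (-1) ^ j) * _ = 0)).resolve_left hch
  rw [Finset.mul_sum, ← hc]
  refine Finset.sum_congr rfl fun x _ => ?_
  rw [neg_pow (complexForm a b x ^ 2), ← pow_mul]
  simp only [α]
  ring

end Isotropic

section Cubature

variable {n : ℕ} {σ : Measure (EuclideanSpace ℝ (Fin n))} [IsProbabilityMeasure σ]

/-- The generating polynomial `u ↦ ∑ x ∈ X, W x (x ⬝ u) ^ d` of the moments of `(X, W)`. -/
noncomputable def momentPolynomial (X : Finset (EuclideanSpace ℝ (Fin n)))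
    (W : EuclideanSpace ℝ (Fin n) → ℝ) (d : ℕ) : MvPolynomial (Fin n) ℂ :=
  ∑ x ∈ X, MvPolynomial.C (W x : ℂ) * MvPolynomial.linearForm (fun i => (x i : ℂ)) ^ d

theorem choose_mul_sum_complexForm_pow {X : Finset (EuclideanSpace ℝ (Fin n))}
    {W : EuclideanSpace ℝ (Fin n) → ℝ} {j k : ℕ} {G : MvPolynomial (Fin n) ℂ}
    (hG : momentPolynomial X W (2 * (j + k)) = (∑ i, MvPolynomial.X i ^ 2) ^ k * G)
    {a b w : EuclideanSpace ℝ (Fin n)} (hab : ⟪a, b⟫ = 0) (hn : ‖a‖ = ‖b‖)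
    (haw : ⟪a, w⟫ = 0) (hbw : ⟪b, w⟫ = 0) :
    ∑ x ∈ X, (W x : ℂ) * ((2 * (j + k)).choose (2 * k) * complexForm a b x ^ (2 * j) *
        (⟪w, x⟫ : ℝ) ^ (2 * k)) =
      (‖w‖ : ℂ) ^ (2 * k) * MvPolynomial.eval (fun i => (a i : ℂ) + b i * Complex.I) G := by
  set z : Fin n → ℂ := fun i => (a i : ℂ) + b i * Complex.I with hz
  let ψ : MvPolynomial (Fin n) ℂ →ₐ[ℂ] Polynomial ℂ :=
    MvPolynomial.aeval fun i => Polynomial.C (z i) + Polynomial.C (w i : ℂ) * Polynomial.X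
  have hcast : ∀ u v : EuclideanSpace ℝ (Fin n),
      ∑ i, (u i : ℂ) * (v i : ℂ) = (⟪u, v⟫ : ℝ) := fun u v => by
    rw [EuclideanSpace.real_inner_eq_sum]
    push_cast
    rfl
  have hzz : ∑ i, z i ^ 2 = 0 := by
    have : ∑ i, z i ^ 2 = ((⟪a, a⟫ : ℝ) : ℂ) + (⟪b, b⟫ : ℝ) * Complex.I ^ 2 +
        2 * (⟪a, b⟫ : ℝ) * Complex.I := by
      simp only [← hcast, Finset.mul_sum, Finset.sum_mul, ← Finset.sum_add_distrib]
      exact Finset.sum_congr rfl fun i _ => by simp only [hz]; ring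
    rw [this, hab, real_inner_self_eq_norm_sq, real_inner_self_eq_norm_sq, hn, Complex.I_sq]
    push_cast
    ring
  have hzw : ∑ i, z i * (w i : ℂ) = 0 := by
    have : ∑ i, z i * (w i : ℂ) = ((⟪a, w⟫ : ℝ) : ℂ) + (⟪b, w⟫ : ℝ) * Complex.I := by
      simp only [← hcast, Finset.sum_mul, ← Finset.sum_add_distrib]
      exact Finset.sum_congr rfl fun i _ => by simp only [hz]; ring
    rw [this, haw, hbw]
    simp
  have hψq : ψ (∑ i, MvPolynomial.X i ^ 2) =
      Polynomial.C ((‖w‖ : ℂ) ^ 2) * Polynomial.X ^ 2 := by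
    have h1 : ψ (∑ i, MvPolynomial.X i ^ 2) = Polynomial.C (∑ i, z i ^ 2) +
        2 * Polynomial.C (∑ i, z i * (w i : ℂ)) * Polynomial.X +
        Polynomial.C (∑ i, (w i : ℂ) * (w i : ℂ)) * Polynomial.X ^ 2 := by
      simp only [ψ, map_sum, map_pow, MvPolynomial.aeval_X, Finset.mul_sum, Finset.sum_mul,
        ← Finset.sum_add_distrib, map_mul]
      exact Finset.sum_congr rfl fun i _ => by ring
    rw [h1, hzz, hzw, hcast, real_inner_self_eq_norm_sq]
    simp
  have hψl : ∀ x : EuclideanSpace ℝ (Fin n), ψ (MvPolynomial.linearForm fun i => (x i : ℂ)) =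
      Polynomial.C (complexForm a b x) + Polynomial.C ((⟪w, x⟫ : ℝ) : ℂ) * Polynomial.X := by
    intro x
    have hzx : complexForm a b x = ∑ i, (x i : ℂ) * z i := by
      simp only [complexForm, ← hcast, Finset.sum_mul, ← Finset.sum_add_distrib]
      exact Finset.sum_congr rfl fun i _ => by simp only [hz]; ring
    rw [hzx, real_inner_comm, ← hcast]
    simp only [ψ, MvPolynomial.linearForm, map_sum, map_mul, MvPolynomial.aeval_X,
      MvPolynomial.aeval_C, Finset.sum_mul, ← Finset.sum_add_distrib]
    exact Finset.sum_congr rfl fun i _ => by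
      simp only [Polynomial.algebraMap_apply, Algebra.algebraMap_self, RingHom.id_apply]
      ring
  have hψ0 : (ψ G).coeff 0 = MvPolynomial.eval z G := by
    have : (Polynomial.evalRingHom 0).comp (ψ : MvPolynomial (Fin n) ℂ →+* Polynomial ℂ) =
        MvPolynomial.eval z :=
      MvPolynomial.ringHom_ext (by simp [ψ]) (by simp [ψ])
    rw [Polynomial.coeff_zero_eq_eval_zero, ← this]
    rfl
  have key := congrArg (fun p => (ψ p).coeff (2 * k)) hG
  simp only [momentPolynomial, map_sum ψ _ X, map_mul ψ, map_pow ψ, hψl, hψq, mul_pow] at key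
  rw [← pow_mul, mul_right_comm, Polynomial.coeff_mul_X_pow', if_pos le_rfl, Nat.sub_self,
    ← map_pow, Polynomial.coeff_C_mul, hψ0, ← pow_mul, Polynomial.finsetSum_coeff] at key
  rw [← key]
  refine Finset.sum_congr rfl fun x _ => ?_
  have hψC : ψ (MvPolynomial.C (W x : ℂ)) = Polynomial.C (W x : ℂ) := by simp [ψ]
  rw [hψC, Polynomial.coeff_C_mul, Polynomial.coeff_linear_pow,
    show 2 * (j + k) - 2 * k = 2 * j by omega]

theorem eval_isotropic_eq_zero (h3 : 3 ≤ n)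
    (hsupp : σ (Metric.sphere (0 : EuclideanSpace ℝ (Fin n)) 1)ᶜ = 0)
    (hinv : ∀ g : EuclideanSpace ℝ (Fin n) ≃ₗᵢ[ℝ] EuclideanSpace ℝ (Fin n),
      MeasurePreserving g σ σ)
    {X : Finset (EuclideanSpace ℝ (Fin n))} (hX : ∀ x ∈ X, ‖x‖ = 1)
    {W : EuclideanSpace ℝ (Fin n) → ℝ} {j k : ℕ} {G : MvPolynomial (Fin n) ℂ}
    (hG : momentPolynomial X W (2 * (j + k)) = (∑ i, MvPolynomial.X i ^ 2) ^ k * G)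
    {a b : EuclideanSpace ℝ (Fin n)} (ha : a ≠ 0) (hab : ⟪a, b⟫ = 0) (hn : ‖a‖ = ‖b‖)
    (hvan : ∑ x ∈ X, (W x : ℂ) * complexForm a b x ^ (2 * j) *
      ((‖a‖ ^ 2 - (⟪a, x⟫ ^ 2 + ⟪b, x⟫ ^ 2) : ℝ) : ℂ) ^ k = 0) :
    MvPolynomial.eval (fun i => (a i : ℂ) + b i * Complex.I) G = 0 := by
  have h0 : ‖a‖ ≠ 0 := norm_ne_zero_iff.2 ha
  have h0' : (‖a‖ : ℂ) ≠ 0 := Complex.ofReal_ne_zero.2 h0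
  have hpt : ∀ u : EuclideanSpace ℝ (Fin n),
      ∑ x ∈ X, (W x : ℂ) * ((2 * (j + k)).choose (2 * k) * complexForm a b x ^ (2 * j)) *
        ((⟪u, pairComplProj a b x⟫ ^ (2 * k) : ℝ) : ℂ) =
      ((‖pairComplProj a b u‖ ^ (2 * k) : ℝ) : ℂ) *
        MvPolynomial.eval (fun i => (a i : ℂ) + b i * Complex.I) G := by
    intro u
    have := choose_mul_sum_complexForm_pow hG hab hn (inner_left_pairComplProj ha hab u)
      (inner_right_pairComplProj ha hab hn u)
    push_cast
    rw [← this]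
    refine Finset.sum_congr rfl fun x _ => ?_
    rw [inner_pairComplProj_comm]
    ring
  obtain ⟨κ, hκ⟩ : ∃ κ, ∀ y, ∫ u, ⟪u, y⟫ ^ (2 * k) ∂σ = ‖y‖ ^ (2 * k) * κ :=
    ⟨_, integral_inner_pow hinv (2 * k) (norm_smul_inv_norm (𝕜 := ℝ) ha)⟩
  have hint := congrArg (fun f : EuclideanSpace ℝ (Fin n) → ℂ => ∫ u, f u ∂σ) (_root_.funext hpt)
  simp only at hint
  rw [integral_mul_const, integral_complex_ofReal, integral_finsetSum _ fun x _ =>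
    integrable_of_continuous_of_sphere hsupp (by fun_prop)] at hint
  simp only [integral_const_mul, integral_complex_ofReal, hκ]
    at hint
  have hzero : ∑ x ∈ X, (W x : ℂ) * ((2 * (j + k)).choose (2 * k) * complexForm a b x ^ (2 * j)) *
      ((‖pairComplProj a b x‖ ^ (2 * k) * κ : ℝ) : ℂ) = 0 := by
    refine (mul_eq_zero.1 (?_ : (‖a‖ : ℂ) ^ (2 * k) * _ = 0)).resolve_left (pow_ne_zero _ h0')
    rw [← mul_zero (((2 * (j + k)).choose (2 * k) : ℂ) * (κ : ℂ)),
      ← hvan, Finset.mul_sum, Finset.mul_sum]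
    refine Finset.sum_congr rfl fun x hx => ?_
    have hs := norm_sq_mul_norm_pairComplProj_sq ha hab hn x
    rw [hX x hx, one_pow, mul_one] at hs
    rw [← hs]
    push_cast
    ring
  rw [hzero] at hint
  exact (mul_eq_zero.1 hint.symm).resolve_left
    (Complex.ofReal_ne_zero.2 (integral_norm_pairComplProj_pow_pos h3 hsupp hinv a b k).ne')

theorem sum_sq_dvd_of_factor (h3 : 3 ≤ n)
    (hsupp : σ (Metric.sphere (0 : EuclideanSpace ℝ (Fin n)) 1)ᶜ = 0)
    (hinv : ∀ g : EuclideanSpace ℝ (Fin n) ≃ₗᵢ[ℝ] EuclideanSpace ℝ (Fin n),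
      MeasurePreserving g σ σ)
    {X : Finset (EuclideanSpace ℝ (Fin n))} (hX : ∀ x ∈ X, ‖x‖ = 1)
    {W : EuclideanSpace ℝ (Fin n) → ℝ} {l : ℕ}
    (hvan : ∀ a b : EuclideanSpace ℝ (Fin n), a ≠ 0 → ⟪a, b⟫ = 0 → ‖a‖ = ‖b‖ →
      ∀ j, 1 ≤ j → j ≤ l → ∑ x ∈ X, (W x : ℂ) * complexForm a b x ^ (2 * j) *
        ((‖a‖ ^ 2 - (⟪a, x⟫ ^ 2 + ⟪b, x⟫ ^ 2) : ℝ) : ℂ) ^ (l - j) = 0)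
    {k : ℕ} (hk : k ≤ l) :
    (∑ i, MvPolynomial.X i ^ 2) ^ k ∣ momentPolynomial X W (2 * l) := by
  induction k with
  | zero => simp
  | succ k ih =>
    obtain ⟨G, hG⟩ := ih (by omega)
    have hdvd : (∑ i, MvPolynomial.X i ^ 2) ∣ G := by
      refine MvPolynomial.sum_sq_dvd_of_eval_isotropic (by omega) fun z hz hzz => ?_
      set a : EuclideanSpace ℝ (Fin n) := WithLp.toLp 2 fun i => (z i).re
      set b : EuclideanSpace ℝ (Fin n) := WithLp.toLp 2 fun i => (z i).im
      have hre : ∑ i, ((z i).re ^ 2 - (z i).im ^ 2) = 0 := by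
        have := congrArg Complex.re hzz
        simpa [sq] using this
      have him : ∑ i, (z i).re * (z i).im = 0 := by
        have h := congrArg Complex.im hzz
        have h2 : ∑ i, 2 * ((z i).re * (z i).im) = 0 := by
          rw [← Complex.zero_im, ← h, Complex.im_sum]
          exact Finset.sum_congr rfl fun i _ => by rw [sq, Complex.mul_im]; ring
        rw [← Finset.mul_sum] at h2
        linarith
      have hab : ⟪a, b⟫ = 0 := by
        rw [EuclideanSpace.real_inner_eq_sum]
        exact him
      have hn : ‖a‖ = ‖b‖ := by
        rw [EuclideanSpace.norm_eq, EuclideanSpace.norm_eq]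
        rw [Finset.sum_sub_distrib, sub_eq_zero] at hre
        simpa [a, b] using congrArg Real.sqrt hre
      have ha : a ≠ 0 := by
        intro h
        have hb : b = 0 := norm_eq_zero.1 (by rw [← hn, h, norm_zero])
        refine hz (_root_.funext fun i => Complex.ext ?_ ?_)
        · exact congrArg (fun v : EuclideanSpace ℝ (Fin n) => v i) h
        · exact congrArg (fun v : EuclideanSpace ℝ (Fin n) => v i) hb
      have hl : 2 * l = 2 * ((l - k) + k) := by omega
      have hv := hvan a b ha hab hn (l - k) (by omega) (by omega)
      rw [show l - (l - k) = k by omega] at hv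
      have := eval_isotropic_eq_zero h3 hsupp hinv hX (hl ▸ hG) ha hab hn hv
      simpa [a, b, Complex.re_add_im] using this
    obtain ⟨G', rfl⟩ := hdvd
    exact ⟨G', by rw [hG]; ring⟩

theorem exists_sum_inner_pow_eq (h3 : 3 ≤ n)
    (hsupp : σ (Metric.sphere (0 : EuclideanSpace ℝ (Fin n)) 1)ᶜ = 0)
    (hinv : ∀ g : EuclideanSpace ℝ (Fin n) ≃ₗᵢ[ℝ] EuclideanSpace ℝ (Fin n),
      MeasurePreserving g σ σ)
    {X : Finset (EuclideanSpace ℝ (Fin n))} (hX : ∀ x ∈ X, ‖x‖ = 1)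
    {W : EuclideanSpace ℝ (Fin n) → ℝ} {l : ℕ}
    (hvan : ∀ a b : EuclideanSpace ℝ (Fin n), a ≠ 0 → ⟪a, b⟫ = 0 → ‖a‖ = ‖b‖ →
      ∀ j, 1 ≤ j → j ≤ l → ∑ x ∈ X, (W x : ℂ) * complexForm a b x ^ (2 * j) *
        ((‖a‖ ^ 2 - (⟪a, x⟫ ^ 2 + ⟪b, x⟫ ^ 2) : ℝ) : ℂ) ^ (l - j) = 0) :
    ∃ g : ℝ, ∀ u : EuclideanSpace ℝ (Fin n),
      ∑ x ∈ X, W x * ⟪u, x⟫ ^ (2 * l) = g * ‖u‖ ^ (2 * l) := by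
  obtain ⟨G, hG⟩ := sum_sq_dvd_of_factor h3 hsupp hinv hX hvan le_rfl
  set q : MvPolynomial (Fin n) ℂ := ∑ i, MvPolynomial.X i ^ 2 with hq
  have hq0 : q ≠ 0 := by
    intro h
    have := congrArg (MvPolynomial.eval (Pi.single (⟨0, by omega⟩ : Fin n) (1 : ℂ))) h
    simp [hq, Pi.single_apply] at this
  have hqh : (q ^ l).IsHomogeneous (2 * l) :=
    (MvPolynomial.IsHomogeneous.sum _ _ _ fun i _ => MvPolynomial.isHomogeneous_X_pow i 2).pow l
  have hFh : (momentPolynomial X W (2 * l)).IsHomogeneous (2 * l) :=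
    MvPolynomial.IsHomogeneous.sum _ _ _ fun x _ => by
      simpa using (MvPolynomial.isHomogeneous_C (Fin n) (W x : ℂ)).mul
        ((MvPolynomial.isHomogeneous_linearForm fun i => (x i : ℂ)).pow (2 * l))
  have hGdeg : G.totalDegree = 0 := by
    by_cases hG0 : G = 0
    · simp [hG0]
    · have := hFh.totalDegree_le
      rw [hG, MvPolynomial.totalDegree_mul_of_isDomain (pow_ne_zero _ hq0) hG0,
        hqh.totalDegree (pow_ne_zero _ hq0)] at this
      omega
  rw [MvPolynomial.totalDegree_eq_zero_iff_eq_C.1 hGdeg] at hG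
  refine ⟨(MvPolynomial.coeff 0 G).re, fun u => ?_⟩
  have hu := congrArg (fun p => (MvPolynomial.eval (fun i => (u i : ℂ)) p).re) hG
  have hl : MvPolynomial.eval (fun i => (u i : ℂ)) (momentPolynomial X W (2 * l)) =
      ((∑ x ∈ X, W x * ⟪u, x⟫ ^ (2 * l) : ℝ) : ℂ) := by
    simp [momentPolynomial, EuclideanSpace.real_inner_eq_sum, mul_comm]
  have hr : MvPolynomial.eval (fun i => (u i : ℂ)) q = ((‖u‖ ^ 2 : ℝ) : ℂ) := by
    simp [hq, EuclideanSpace.real_norm_sq_eq]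
  simp only [map_mul, map_pow, hl, hr, MvPolynomial.eval_C] at hu
  rw [← Complex.ofReal_pow, Complex.re_ofReal_mul, Complex.ofReal_re] at hu
  rw [hu, pow_mul, mul_comm]

end Cubature

/-- (converse to 4.2, for `n ≥ 3`) if, for an antipodal symmetrically
weighted set `(X,W)` on `𝕊^{n-1}` with total weight `1`, the Markov operator
`∑_{x∈X} W(x) π^{(l)}(s_x)` on `H^{(l)}(𝕊^{n-1})` is a scalar multiple `c·id` of the
identity, then `(X,W)` is a cubature formula of strength `2l+1`. -/
theorem cubature_of_markov_operator_scalar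
    (n l : ℕ) (hn : 3 ≤ n)
    (σ : Measure (EuclideanSpace ℝ (Fin n))) [IsProbabilityMeasure σ]
    (hsupp : σ (Metric.sphere (0 : EuclideanSpace ℝ (Fin n)) 1)ᶜ = 0)
    (hinv : ∀ g : EuclideanSpace ℝ (Fin n) ≃ₗᵢ[ℝ] EuclideanSpace ℝ (Fin n),
      MeasurePreserving g σ σ)
    (X : Finset (EuclideanSpace ℝ (Fin n))) (hX : X.Nonempty)
    (hXs : ∀ x ∈ X, x ∈ Metric.sphere (0 : EuclideanSpace ℝ (Fin n)) 1)
    (hanti : ∀ x ∈ X, -x ∈ X)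
    (W : EuclideanSpace ℝ (Fin n) → ℝ) (hW : ∀ x ∈ X, 0 < W x)
    (hWsymm : ∀ x ∈ X, W (-x) = W x) (hW1 : ∑ x ∈ X, W x = 1)
    (c : ℝ)
    (hscalar : ∀ p : MvPolynomial (Fin n) ℝ, p.IsHomogeneous l →
      (∑ i : Fin n, MvPolynomial.pderiv i (MvPolynomial.pderiv i p)) = 0 →
      ∀ ω ∈ Metric.sphere (0 : EuclideanSpace ℝ (Fin n)) 1,
        ∑ x ∈ X, W x * MvPolynomial.eval (fun i => (ω - (2 * ⟪x, ω⟫) • x) i) p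
          = c * MvPolynomial.eval (fun i => ω i) p) :
    ∀ p : MvPolynomial (Fin n) ℝ, p.totalDegree ≤ 2 * l + 1 →
        ∑ x ∈ X, W x * MvPolynomial.eval (fun i => x i) p
          = ∫ ω, MvPolynomial.eval (fun i => ω i) p ∂σ := by
  have hX1 : ∀ x ∈ X, ‖x‖ = 1 := fun x hx => by simpa using hXs x hx
  have hcont : ∀ p : MvPolynomial (Fin n) ℝ,
      Continuous fun ω : EuclideanSpace ℝ (Fin n) => MvPolynomial.eval (fun i => ω i) p :=
    fun p => (MvPolynomial.continuous_eval p).comp (by fun_prop)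
  have hintg := fun p => integrable_of_continuous_of_sphere (σ := σ) hsupp (hcont p)
  let D : MvPolynomial (Fin n) ℝ →ₗ[ℝ] ℝ :=
    { toFun := fun p => ∑ x ∈ X, W x * MvPolynomial.eval (fun i => x i) p -
        ∫ ω, MvPolynomial.eval (fun i => ω i) p ∂σ
      map_add' := fun p q => by
        simp only [map_add, mul_add, Finset.sum_add_distrib]
        rw [integral_add (hintg p) (hintg q)]
        ring
      map_smul' := fun r p => by
        simp only [MvPolynomial.smul_eval, integral_const_mul, RingHom.id_apply, smul_eq_mul,
          mul_sub, Finset.mul_sum]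
        congr 1
        exact Finset.sum_congr rfl fun x _ => by ring }
  have hDapp : ∀ p, D p = ∑ x ∈ X, W x * MvPolynomial.eval (fun i => x i) p -
        ∫ ω, MvPolynomial.eval (fun i => ω i) p ∂σ := fun _ => rfl
  obtain ⟨g, hg⟩ := exists_sum_inner_pow_eq hn hsupp hinv hX1 (W := W) (l := l)
    fun a b ha hab hab' j hj hjl => sum_complexForm_pow_mul_eq_zero ha hab hab'
      (fun ω hω => sum_complexForm_reflection_pow hscalar hab hab' hω) hj hjl
  obtain ⟨e, heX⟩ := hX
  obtain ⟨κ, hκ⟩ : ∃ κ, ∀ y, ∫ u, ⟪u, y⟫ ^ (2 * l) ∂σ = ‖y‖ ^ (2 * l) * κ :=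
    ⟨_, integral_inner_pow hinv (2 * l) (hX1 e heX)⟩
  have hκg : κ = g := by
    have h1 : ∫ u, ∑ x ∈ X, W x * ⟪u, x⟫ ^ (2 * l) ∂σ = κ := by
      rw [integral_finsetSum _ fun x _ =>
        integrable_of_continuous_of_sphere hsupp (by fun_prop)]
      simp only [integral_const_mul, hκ]
      refine (Finset.sum_congr rfl fun x hx => ?_ : _ = ∑ x ∈ X, W x * κ).trans
        (by rw [← Finset.sum_mul, hW1, one_mul])
      rw [hX1 x hx, one_pow, one_mul]
    have h2 : ∫ u, ∑ x ∈ X, W x * ⟪u, x⟫ ^ (2 * l) ∂σ = g := by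
      rw [integral_congr_ae (g := fun _ => g)]
      · simp
      · filter_upwards [ae_norm_eq_one hsupp] with u hu
        rw [hg, hu, one_pow, mul_one]
    rw [← h1, h2]
  have hDtop : ∀ p : MvPolynomial (Fin n) ℝ, p.IsHomogeneous (2 * l) → D p = 0 := by
    refine fun p => MvPolynomial.eq_zero_of_linearForm_pow D (2 * l) fun u => ?_
    have hev : ∀ x : EuclideanSpace ℝ (Fin n),
        MvPolynomial.eval (fun i => x i) (MvPolynomial.linearForm u ^ (2 * l)) =
          ⟪WithLp.toLp 2 u, x⟫ ^ (2 * l) := fun x => by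
      simp [EuclideanSpace.real_inner_eq_sum]
    simp only [hDapp, hev, hg]
    simp only [real_inner_comm _ (WithLp.toLp 2 u)]
    rw [hκ, hκg]
    ring
  have hDhom : ∀ (d : ℕ) (p : MvPolynomial (Fin n) ℝ), p.IsHomogeneous d → d ≤ 2 * l + 1 →
      D p = 0 := by
    intro d p hp hd
    rcases Nat.even_or_odd' d with ⟨k, rfl | rfl⟩
    · have hmul : (p * (∑ i, MvPolynomial.X i ^ 2) ^ (l - k)).IsHomogeneous (2 * l) := by
        have := hp.mul ((MvPolynomial.IsHomogeneous.sum univ _ 2 fun (i : Fin n) _ =>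
          MvPolynomial.isHomogeneous_X_pow (R := ℝ) i 2).pow (l - k))
        rwa [show 2 * k + 2 * (l - k) = 2 * l by omega] at this
      have hev : ∀ x : EuclideanSpace ℝ (Fin n), ‖x‖ = 1 →
          MvPolynomial.eval (fun i => x i) (p * (∑ i, MvPolynomial.X i ^ 2) ^ (l - k)) =
            MvPolynomial.eval (fun i => x i) p := by
        intro x hx
        have : ∑ i, x i ^ 2 = 1 := by rw [← EuclideanSpace.real_norm_sq_eq, hx, one_pow]
        simp [this]
      rw [← hDtop _ hmul, hDapp, hDapp]
      congr 1
      · exact Finset.sum_congr rfl fun x hx => by rw [hev x (hX1 x hx)]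
      · refine integral_congr_ae ?_
        filter_upwards [ae_norm_eq_one hsupp] with x hx using (hev x hx).symm
    · have hev : ∀ x : EuclideanSpace ℝ (Fin n),
          MvPolynomial.eval (fun i => (-x) i) p = -MvPolynomial.eval (fun i => x i) p := by
        intro x
        have := hp.eval_const_mul (-1) (fun i => x i)
        rw [(odd_two_mul_add_one k).neg_one_pow, neg_one_mul] at this
        simpa using this
      have h1 : ∑ x ∈ X, W x * MvPolynomial.eval (fun i => x i) p =
          -∑ x ∈ X, W x * MvPolynomial.eval (fun i => x i) p := by
        rw [← Finset.sum_neg_distrib]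
        refine Finset.sum_bij' (fun x _ => -x) (fun x _ => -x) hanti hanti
          (fun x _ => neg_neg x) (fun x _ => neg_neg x) fun x hx => ?_
        rw [hev, hWsymm x hx]
        ring
      have h2 : ∫ ω, MvPolynomial.eval (fun i => ω i) p ∂σ =
          -∫ ω, MvPolynomial.eval (fun i => ω i) p ∂σ := by
        rw [← integral_neg]
        have hneg := hinv (LinearIsometryEquiv.neg ℝ)
        rw [← hneg.integral_comp
          (LinearIsometryEquiv.neg ℝ).toHomeomorph.measurableEmbedding]
        exact integral_congr_ae (Filter.Eventually.of_forall hev)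
      rw [hDapp]
      linarith
  intro p hp
  rw [← sub_eq_zero, ← hDapp, ← MvPolynomial.sum_homogeneousComponent p, map_sum]
  exact Finset.sum_eq_zero fun d hd => hDhom d _
    (MvPolynomial.homogeneousComponent_isHomogeneous d p) (by
      have := Finset.mem_range.1 hd
      omega)
end
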